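/- Let (V, ω) be a simple VOA of strong CFT type. Then the natural map (V_2 ∩ CV_CFT)/Aut_ω V → CV_CFT/Aut V, induced by the inclusion V_2 ∩ CV_CFT ⊆ CV_CFT, is a bijection between the orbit sets. -/

import Mathlib

/-!
Common framework: vertex algebras, ℤ-graded (conformal) vertex algebras,
conformal vectors, automorphism groups, following Moriwaki,
"On classification of conformal vectors in vertex operator algebra and
the vertex algebra automorphism group".
-/

noncomputable section

open scoped BigOperators

/-- The generalized binomial coefficient `binom(m, i)` for `m : ℤ`, valued in a field `K`. -/
def zBinom (K : Type*) [Field K] (m : ℤ) (i : ℕ) : K :=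
  (∏ j ∈ Finset.range i, ((m : K) - (j : K))) / (Nat.factorial i : K)

/-- A vertex algebra over a field `K`: a `K`-vector space `V` equipped with bilinear
`n`-th products `a(n)b` (`n : ℤ`) and a vacuum vector `𝟙`, subject to the truncation
condition, the vacuum and creation axioms, and the Borcherds identity. -/
structure VA (K V : Type*) [Field K] [AddCommGroup V] [Module K V] where
  /-- the `n`-th product `a(n)b`, bilinear in `a` and `b` -/
  ncoef : ℤ → V →ₗ[K] V →ₗ[K] V
  /-- the vacuum vector `𝟙` -/
  vac : V
  /-- truncation: `a(n)b = 0` for `n` sufficiently large -/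
  trunc : ∀ a b : V, ∃ N : ℤ, ∀ n : ℤ, N ≤ n → ncoef n a b = 0
  /-- the vacuum axiom `Y(𝟙, z) = id`, i.e. `𝟙(n)a = δ_{n,-1} a` -/
  vac_ncoef : ∀ (n : ℤ) (a : V), ncoef n vac a = if n = -1 then a else 0
  /-- creation: `a(-1)𝟙 = a` -/
  ncoef_vac : ∀ a : V, ncoef (-1) a vac = a
  /-- creation: `a(n)𝟙 = 0` for `n ≥ 0` -/
  ncoef_vac_zero : ∀ n : ℤ, 0 ≤ n → ∀ a : V, ncoef n a vac = 0
  /-- the Borcherds identity -/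
  borcherds : ∀ (a b c : V) (p q m : ℤ),
    (∑ᶠ i : ℕ, zBinom K m i •
        ncoef (m + q - (i : ℤ)) (ncoef (p + (i : ℤ)) a b) c)
      = ∑ᶠ i : ℕ, ((-1 : K) ^ i * zBinom K p i) •
          (ncoef (m + p - (i : ℤ)) a (ncoef (q + (i : ℤ)) b c)
            - ((p.negOnePow : ℤ) : K) •
                ncoef (p + q - (i : ℤ)) b (ncoef (m + (i : ℤ)) a c))

namespace VA

variable {K V : Type*} [Field K] [AddCommGroup V] [Module K V]

/-- The translation operator `T a = a(-2)𝟙`. -/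
def T (A : VA K V) : V →ₗ[K] V := (A.ncoef (-2)).flip A.vac

/-- The eigenspace `V_n^a = {v ∈ V | a(1)v = n v}` of `a(1)`. -/
def eig (A : VA K V) (a : V) (n : ℤ) : Submodule K V :=
  LinearMap.ker (A.ncoef 1 a - (n : K) • (LinearMap.id : V →ₗ[K] V))

/-- `a` is a conformal vector: `a(1)a = 2a`, `a(3)a ∈ K𝟙`, `a(2)a = 0`, `a(n)a = 0`
for `n ≥ 4`, `a(0) = T`, and `a(1)` is semisimple with integer eigenvalues
(`V = ⊕_{n ∈ ℤ} V_n^a`). -/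
def IsConformal (A : VA K V) (a : V) : Prop :=
  A.ncoef 1 a a = (2 : K) • a ∧
  (∃ c : K, A.ncoef 3 a a = c • A.vac) ∧
  A.ncoef 2 a a = 0 ∧
  (∀ n : ℤ, 4 ≤ n → A.ncoef n a a = 0) ∧
  A.ncoef 0 a = A.T ∧
  DirectSum.IsInternal (A.eig a)

/-- `a` is a conformal vector of CFT type: `(V, a)` is a VOA of CFT type, i.e.
`V = ⊕_{n ∈ ℕ} V_n^a` with finite-dimensional pieces and `V_0^a = K𝟙`. -/
def IsConformalCFT (A : VA K V) (a : V) : Prop :=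
  A.IsConformal a ∧
  (∀ n : ℤ, n < 0 → A.eig a n = ⊥) ∧
  (∀ n : ℤ, FiniteDimensional K (A.eig a n)) ∧
  A.eig a 0 = Submodule.span K {A.vac}

/-- `a` is a conformal vector of strong CFT type: of CFT type and `a(2)V_1^a = 0`
(i.e. `L^a(1) V_1^a = 0`). -/
def IsConformalSCFT (A : VA K V) (a : V) : Prop :=
  A.IsConformalCFT a ∧ ∀ v ∈ A.eig a 1, A.ncoef 2 a v = 0

/-- A vertex algebra homomorphism: a linear map preserving all products and the vacuum. -/
structure IsVAHom (A : VA K V) (f : V → V) : Prop where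
  map_add : ∀ a b : V, f (a + b) = f a + f b
  map_smul : ∀ (c : K) (a : V), f (c • a) = c • f a
  map_ncoef : ∀ (n : ℤ) (a b : V), f (A.ncoef n a b) = A.ncoef n (f a) (f b)
  map_vac : f A.vac = A.vac

/-- A vertex algebra automorphism: a bijective vertex algebra homomorphism. -/
def IsVAAut (A : VA K V) (f : V → V) : Prop :=
  A.IsVAHom f ∧ Function.Bijective f

/-- A (two-sided) ideal of a vertex algebra. -/
def IsIdeal (A : VA K V) (I : Submodule K V) : Prop :=
  ∀ (n : ℤ) (a : V), ∀ b ∈ I, A.ncoef n a b ∈ I ∧ A.ncoef n b a ∈ I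

/-- A vertex algebra is simple if it has no ideals other than `0` and itself. -/
def IsSimple (A : VA K V) : Prop :=
  ∀ I : Submodule K V, A.IsIdeal I → I = ⊥ ∨ I = ⊤

end VA

/-- The exponential `exp f = Σ_{n≥0} f^n / n!` of an endomorphism, as a function
(meaningful for locally nilpotent `f`). -/
def expOp {K V : Type*} [Field K] [AddCommGroup V] [Module K V]
    (f : V →ₗ[K] V) (v : V) : V :=
  ∑ᶠ n : ℕ, (Nat.factorial n : K)⁻¹ • (f ^ n) v

/-- A ℤ-grading on a vertex algebra, making it a ℤ-graded vertex algebra: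
`V = ⊕_{n ∈ ℤ} V_n`, `V_n(k)V_m ⊆ V_{n+m-k-1}` and `𝟙 ∈ V_0`. -/
structure GradedVA {K V : Type*} [Field K] [AddCommGroup V] [Module K V] (A : VA K V) where
  /-- the grading subspaces `V_n` -/
  gr : ℤ → Submodule K V
  /-- `V = ⊕_{n ∈ ℤ} V_n` -/
  decomp : DirectSum.Decomposition gr
  /-- `𝟙 ∈ V_0` -/
  vac_mem : A.vac ∈ gr 0
  /-- `V_n(k)V_m ⊆ V_{n+m-k-1}` -/
  ncoef_mem : ∀ (n m k : ℤ), ∀ a ∈ gr n, ∀ b ∈ gr m, A.ncoef k a b ∈ gr (n + m - k - 1)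

namespace GradedVA

variable {K V : Type*} [Field K] [AddCommGroup V] [Module K V] {A : VA K V}

/-- The canonical projection `pr_n : V → V_n`. -/
def pr (G : GradedVA A) (n : ℤ) (v : V) : V :=
  letI := G.decomp
  (DirectSum.decompose G.gr v n : V)

/-- `V_{≥n} = ⊕_{i ≥ n} V_i`. -/
def ge (G : GradedVA A) (n : ℤ) : Submodule K V := ⨆ i ≥ n, G.gr i

/-- `V_{≤n} = ⊕_{i ≤ n} V_i`. -/
def le (G : GradedVA A) (n : ℤ) : Submodule K V := ⨆ i ≤ n, G.gr i

/-- `J_1(V) = {a ∈ V_1 | a(0) = 0}`. -/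
def J1 (G : GradedVA A) : Set V :=
  {a : V | a ∈ G.gr 1 ∧ A.ncoef 0 a = 0}

/-- `Aut⁺V`: automorphisms `f` with `f(V_n) ⊆ V_{≥n}` and `pr_n ∘ f|_{V_n} = id`. -/
def AutPlus (G : GradedVA A) (f : V → V) : Prop :=
  A.IsVAAut f ∧ ∀ n : ℤ, ∀ v ∈ G.gr n, f v ∈ G.ge n ∧ G.pr n (f v) = v

/-- `Aut⁻V`: automorphisms `f` with `f(V_n) ⊆ ⊕_{k ≤ n} V_k` and `pr_n ∘ f|_{V_n} = id`. -/
def AutMinus (G : GradedVA A) (f : V → V) : Prop :=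
  A.IsVAAut f ∧ ∀ n : ℤ, ∀ v ∈ G.gr n, f v ∈ G.le n ∧ G.pr n (f v) = v

/-- `Aut⁰V`: automorphisms `f` with `f(V_n) ⊆ V_n`. -/
def AutZero (G : GradedVA A) (f : V → V) : Prop :=
  A.IsVAAut f ∧ ∀ n : ℤ, ∀ v ∈ G.gr n, f v ∈ G.gr n

end GradedVA

/-- A ℤ-graded conformal vertex algebra: a ℤ-graded vertex algebra with a conformal
vector `ω ∈ V_2` whose modes `L(n) = ω(n+1)` satisfy the Virasoro relations, with
`L(0)v = n v` for `v ∈ V_n` and `L(-1) = T`. -/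
structure ConfGVA {K V : Type*} [Field K] [AddCommGroup V] [Module K V] (A : VA K V)
    extends GradedVA A where
  /-- the conformal vector -/
  ω : V
  ω_mem : ω ∈ gr 2
  /-- the Virasoro relations `[L(n), L(m)] = (n-m)L(n+m) + δ_{n+m,0}((n³-n)/12)c` -/
  virasoro : ∃ c : K, ∀ n m : ℤ,
    A.ncoef (n + 1) ω ∘ₗ A.ncoef (m + 1) ω - A.ncoef (m + 1) ω ∘ₗ A.ncoef (n + 1) ω
      = ((n : K) - (m : K)) • A.ncoef (n + m + 1) ω
        + (if n + m = 0 then ((n : K) ^ 3 - (n : K)) / 12 * c else 0)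
            • (LinearMap.id : V →ₗ[K] V)
  /-- `L(0) v = n v` for `v ∈ V_n` -/
  L0_grading : ∀ n : ℤ, ∀ v ∈ gr n, A.ncoef 1 ω v = (n : K) • v
  /-- `L(-1) = T` -/
  Lneg1_eq_T : A.ncoef 0 ω = A.T

namespace ConfGVA

variable {K V : Type*} [Field K] [AddCommGroup V] [Module K V] {A : VA K V}

abbrev pr (C : ConfGVA A) : ℤ → V → V := C.toGradedVA.pr
abbrev ge (C : ConfGVA A) : ℤ → Submodule K V := C.toGradedVA.ge
abbrev le (C : ConfGVA A) : ℤ → Submodule K V := C.toGradedVA.le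
abbrev J1 (C : ConfGVA A) : Set V := C.toGradedVA.J1
abbrev AutPlus (C : ConfGVA A) : (V → V) → Prop := C.toGradedVA.AutPlus
abbrev AutMinus (C : ConfGVA A) : (V → V) → Prop := C.toGradedVA.AutMinus
abbrev AutZero (C : ConfGVA A) : (V → V) → Prop := C.toGradedVA.AutZero

/-- `Aut_ω V`: the VOA automorphisms, i.e. the stabilizer of `ω` in `Aut V`. -/
def AutOmega (C : ConfGVA A) (f : V → V) : Prop :=
  A.IsVAAut f ∧ f C.ω = C.ω

/-- An invariant bilinear form on `(V, ω)`:
`(a(n)b, c) = (-1)^d Σ_{j≥0} (1/j!) (b, (L(1)^j a)(2d-n-2-j) c)` for `a ∈ V_d`, which is the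
coefficient form of `(Y(a,z)b, c) = (b, Y(e^{zL(1)}(-z^{-2})^{L(0)} a, z^{-1}) c)`. -/
def IsInvForm (C : ConfGVA A) (B : V →ₗ[K] V →ₗ[K] K) : Prop :=
  ∀ d : ℤ, ∀ a ∈ C.gr d, ∀ (b c : V) (n : ℤ),
    B (A.ncoef n a b) c
      = ((d.negOnePow : ℤ) : K) *
          ∑ᶠ j : ℕ, (Nat.factorial j : K)⁻¹ *
            B b (A.ncoef (2 * d - n - 2 - (j : ℤ)) ((A.ncoef 2 C.ω ^ j) a) c)

end ConfGVA

/-- A VOA of CFT type: a ℤ-graded conformal vertex algebra with `V = ⊕_{n ∈ ℕ} V_n`,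
`dim V_n < ∞`, and `V_0 = K𝟙`. -/
structure VOACFT {K V : Type*} [Field K] [AddCommGroup V] [Module K V] (A : VA K V)
    extends ConfGVA A where
  gr_neg : ∀ n : ℤ, n < 0 → gr n = ⊥
  gr_fd : ∀ n : ℤ, FiniteDimensional K (gr n)
  gr_zero : gr 0 = Submodule.span K {A.vac}

namespace VOACFT

variable {K V : Type*} [Field K] [AddCommGroup V] [Module K V] {A : VA K V}

abbrev pr (W : VOACFT A) : ℤ → V → V := W.toConfGVA.pr
abbrev ge (W : VOACFT A) : ℤ → Submodule K V := W.toConfGVA.ge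
abbrev le (W : VOACFT A) : ℤ → Submodule K V := W.toConfGVA.le
abbrev J1 (W : VOACFT A) : Set V := W.toConfGVA.J1
abbrev AutPlus (W : VOACFT A) : (V → V) → Prop := W.toConfGVA.AutPlus
abbrev AutMinus (W : VOACFT A) : (V → V) → Prop := W.toConfGVA.AutMinus
abbrev AutZero (W : VOACFT A) : (V → V) → Prop := W.toConfGVA.AutZero
abbrev AutOmega (W : VOACFT A) : (V → V) → Prop := W.toConfGVA.AutOmega
abbrev IsInvForm (W : VOACFT A) : (V →ₗ[K] V →ₗ[K] K) → Prop := W.toConfGVA.IsInvForm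

end VOACFT

/-- A VOA of strong CFT type: a VOA of CFT type with `L(1)V_1 = 0`. -/
structure VOAsCFT {K V : Type*} [Field K] [AddCommGroup V] [Module K V] (A : VA K V)
    extends VOACFT A where
  L1_V1 : ∀ v ∈ gr 1, A.ncoef 2 ω v = 0

namespace VOAsCFT

variable {K V : Type*} [Field K] [AddCommGroup V] [Module K V] {A : VA K V}

abbrev pr (W : VOAsCFT A) : ℤ → V → V := W.toVOACFT.pr
abbrev ge (W : VOAsCFT A) : ℤ → Submodule K V := W.toVOACFT.ge
abbrev le (W : VOAsCFT A) : ℤ → Submodule K V := W.toVOACFT.le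
abbrev J1 (W : VOAsCFT A) : Set V := W.toVOACFT.J1
abbrev AutPlus (W : VOAsCFT A) : (V → V) → Prop := W.toVOACFT.AutPlus
abbrev AutMinus (W : VOAsCFT A) : (V → V) → Prop := W.toVOACFT.AutMinus
abbrev AutZero (W : VOAsCFT A) : (V → V) → Prop := W.toVOACFT.AutZero
abbrev AutOmega (W : VOAsCFT A) : (V → V) → Prop := W.toVOACFT.AutOmega
abbrev IsInvForm (W : VOAsCFT A) : (V →ₗ[K] V →ₗ[K] K) → Prop := W.toVOACFT.IsInvForm

end VOAsCFT

end

namespace InternalGrading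

section Projection

variable {K V : Type*} [Field K] [AddCommGroup V] [Module K V] {U : ℤ → Submodule K V}

/-- The isomorphism of `V` with the external direct sum of the subspaces `U n`. -/
noncomputable def decomp (hU : DirectSum.IsInternal U) :
    V ≃ₗ[K] DirectSum ℤ fun i => U i :=
  (LinearEquiv.ofBijective (DirectSum.coeLinearMap U)
    (show Function.Bijective (DirectSum.coeLinearMap U) from hU)).symm

/-- The projection of `V = ⨁ U n` onto `U n`, as an endomorphism of `V`. -/
noncomputable def proj (hU : DirectSum.IsInternal U) (n : ℤ) : V →ₗ[K] V :=
  (U n).subtype ∘ₗ DirectSum.component K ℤ (fun i => U i) n ∘ₗ (decomp hU).toLinearMap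

variable (hU : DirectSum.IsInternal U)

lemma proj_mem (n : ℤ) (v : V) : proj hU n v ∈ U n := by
  simp [proj]

lemma decomp_of_mem {n : ℤ} {v : V} (hv : v ∈ U n) :
    decomp hU v = DirectSum.lof K ℤ (fun i => U i) n ⟨v, hv⟩ := by
  rw [decomp, LinearEquiv.symm_apply_eq]
  simp [DirectSum.coeLinearMap_lof]

lemma proj_of_mem {n : ℤ} {v : V} (hv : v ∈ U n) : proj hU n v = v := by
  simp [proj, decomp_of_mem hU hv, DirectSum.component.lof_self]

lemma proj_of_mem_ne {m n : ℤ} {v : V} (hv : v ∈ U m) (h : m ≠ n) : proj hU n v = 0 := by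
  simp [proj, decomp_of_mem hU hv, DirectSum.component.of, h]

include hU in
lemma iSup_eq_top : ⨆ n, U n = ⊤ :=
  ((DirectSum.isInternal_submodule_iff_iSupIndep_and_iSup_eq_top U).1 hU).2

include hU in
@[elab_as_elim]
lemma induction_on {p : V → Prop} (v : V) (hmem : ∀ n, ∀ x ∈ U n, p x) (h0 : p 0)
    (hadd : ∀ x y, p x → p y → p (x + y)) : p v :=
  Submodule.iSup_induction U (motive := p) (by rw [iSup_eq_top hU]; trivial) hmem h0 hadd

lemma exists_sum (v : V) :
    ∃ s : Finset ℤ, (∀ n ∉ s, proj hU n v = 0) ∧ v = ∑ n ∈ s, proj hU n v := by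
  classical
  refine induction_on hU v (fun n x hx => ⟨{n}, ?_, ?_⟩) ⟨∅, by simp, by simp⟩ ?_
  · intro m hm
    exact proj_of_mem_ne hU hx (by simpa [eq_comm] using hm)
  · simp [proj_of_mem hU hx]
  · rintro x y ⟨s, hs, hs'⟩ ⟨t, ht, ht'⟩
    refine ⟨s ∪ t, ?_, ?_⟩
    · intro n hn
      simp only [Finset.mem_union, not_or] at hn
      rw [map_add, hs n hn.1, ht n hn.2, add_zero]
    · simp only [map_add, Finset.sum_add_distrib]
      rw [← Finset.sum_subset Finset.subset_union_left (fun n _ hn => hs n hn),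
        ← Finset.sum_subset Finset.subset_union_right (fun n _ hn => ht n hn), ← hs', ← ht']

lemma eq_zero_of_proj {v : V} (h : ∀ n, proj hU n v = 0) : v = 0 := by
  obtain ⟨s, -, hs⟩ := exists_sum hU v
  rw [hs]
  exact Finset.sum_eq_zero fun n _ => h n

lemma mem_of_proj_mem {v : V} {Q : Submodule K V} (h : ∀ n, proj hU n v ∈ Q) : v ∈ Q := by
  obtain ⟨s, -, hs⟩ := exists_sum hU v
  rw [hs]
  exact Submodule.sum_mem _ fun n _ => h n

lemma proj_map {U' : ℤ → Submodule K V} (hU' : DirectSum.IsInternal U') (φ : V →ₗ[K] V) (k : ℤ)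
    (h : ∀ n, ∀ x ∈ U n, φ x ∈ U' (n + k)) (n : ℤ) (v : V) :
    proj hU' (n + k) (φ v) = φ (proj hU n v) := by
  refine induction_on hU v (fun m x hx => ?_) (by simp) fun x y hx hy => by simp [hx, hy]
  by_cases hmn : m = n
  · subst hmn
    rw [proj_of_mem hU hx, proj_of_mem hU' (h _ _ hx)]
  · rw [proj_of_mem_ne hU hx hmn, proj_of_mem_ne hU' (h _ _ hx) (by omega), map_zero]

lemma linearMap_ext {φ ψ : V →ₗ[K] V} (hU : DirectSum.IsInternal U)
    (h : ∀ n, ∀ x ∈ U n, φ x = ψ x) : φ = ψ := by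
  ext v
  exact induction_on hU v h (by simp) fun x y hx hy => by simp [hx, hy]

/-- The subspace `⨁_{i ≥ n} U i`. -/
noncomputable def filt (n : ℤ) : Submodule K V := ⨅ i : {i : ℤ // i < n}, LinearMap.ker (proj hU i)

lemma mem_filt {n : ℤ} {v : V} : v ∈ filt hU n ↔ ∀ i < n, proj hU i v = 0 := by
  simp [filt]

lemma filt_anti {m n : ℤ} (h : m ≤ n) : filt hU n ≤ filt hU m := fun _ hv =>
  (mem_filt hU).2 fun i hi => (mem_filt hU).1 hv i (by omega)

lemma mem_filt_of_mem {m n : ℤ} {v : V} (hv : v ∈ U m) (h : n ≤ m) : v ∈ filt hU n :=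
  (mem_filt hU).2 fun _ hi => proj_of_mem_ne hU hv (by omega)

lemma sub_proj_mem_filt {n : ℤ} {v : V} (hv : v ∈ filt hU n) :
    v - proj hU n v ∈ filt hU (n + 1) := by
  refine (mem_filt hU).2 fun i hi => ?_
  rw [map_sub]
  rcases eq_or_ne i n with rfl | hne
  · rw [proj_of_mem hU (proj_mem hU _ _), sub_self]
  · rw [(mem_filt hU).1 hv i (by omega), proj_of_mem_ne hU (proj_mem hU n v) hne.symm, sub_zero]

lemma filt_succ_of_proj {n : ℤ} {v : V} (hv : v ∈ filt hU n) (h : proj hU n v = 0) :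
    v ∈ filt hU (n + 1) := by
  simpa [h] using sub_proj_mem_filt hU hv

lemma exists_mem_filt (v : V) : ∃ n, v ∈ filt hU n := by
  obtain ⟨s, hs, -⟩ := exists_sum hU v
  obtain ⟨n, hn⟩ := s.bddBelow
  exact ⟨n, (mem_filt hU).2 fun i hi => hs i fun his => by have := hn his; omega⟩

lemma mem_filt_of_step {v : V} (m : ℤ) (h : ∀ n < m, v ∈ filt hU n → v ∈ filt hU (n + 1)) :
    v ∈ filt hU m := by
  obtain ⟨n, hn⟩ := exists_mem_filt hU v
  rcases le_total m n with hmn | hmn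
  · exact filt_anti hU hmn hn
  · have : ∀ k : ℕ, n + k ≤ m → v ∈ filt hU (n + k) := by
      intro k
      induction k with
      | zero => intro _; simpa using hn
      | succ k ih =>
        intro hk
        have := h (n + k) (by push_cast at hk; omega) (ih (by push_cast at hk; omega))
        simpa [add_assoc] using this
    have h' := this (m - n).toNat (by omega)
    rwa [show n + ((m - n).toNat : ℤ) = m by omega] at h'

lemma eq_zero_of_step {v : V} (h : ∀ n, v ∈ filt hU n → v ∈ filt hU (n + 1)) : v = 0 :=
  eq_zero_of_proj hU fun n =>
    (mem_filt hU).1 (mem_filt_of_step hU (n + 1) fun i _ => h i) n (by omega)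

lemma map_filt {U' : ℤ → Submodule K V} (hU' : DirectSum.IsInternal U') (φ : V →ₗ[K] V) (k n : ℤ)
    (h : ∀ i ≥ n, ∀ x ∈ U i, φ x ∈ filt hU' (i + k)) {v : V} (hv : v ∈ filt hU n) :
    φ v ∈ filt hU' (n + k) := by
  obtain ⟨s, -, hs⟩ := exists_sum hU v
  rw [hs, map_sum]
  refine Submodule.sum_mem _ fun i _ => ?_
  by_cases hi : i < n
  · rw [(mem_filt hU).1 hv i hi, map_zero]
    exact Submodule.zero_mem _
  · exact filt_anti hU' (by omega) (h i (by omega) _ (proj_mem hU _ _))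

end Projection

section Operator

variable {K V : Type*} [Field K] [AddCommGroup V] [Module K V]

/-- The eigenspaces of `D` with integral eigenvalues. -/
def eigen (D : V →ₗ[K] V) (n : ℤ) : Submodule K V :=
  LinearMap.ker (D - (n : K) • (LinearMap.id : V →ₗ[K] V))

lemma mem_eigen {D : V →ₗ[K] V} {n : ℤ} {v : V} : v ∈ eigen D n ↔ D v = (n : K) • v := by
  simp [eigen, sub_eq_zero]

lemma isInternal_eigen_iff [CharZero K] {D : V →ₗ[K] V} :
    DirectSum.IsInternal (eigen D) ↔ ⨆ n, eigen D n = ⊤ := by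
  rw [DirectSum.isInternal_submodule_iff_iSupIndep_and_iSup_eq_top]
  refine and_iff_right ?_
  have h := (Module.End.eigenspaces_iSupIndep D).comp (f := fun n : ℤ => (n : K)) Int.cast_injective
  convert h using 1
  funext n
  ext v
  rw [mem_eigen, Function.comp_apply, Module.End.mem_eigenspace_iff]

lemma proj_eigen_mem [CharZero K] {D : V →ₗ[K] V} (hD : DirectSum.IsInternal (eigen D))
    {p : Submodule K V}
    (hp : ∀ x ∈ p, D x ∈ p) {v : V} (hv : v ∈ p) (n : ℤ) : proj hD n v ∈ p := by
  classical
  have key : ∀ (s : Finset ℤ) (x : ℤ → V), (∀ l, D (x l) = (l : K) • x l) →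
      ∑ l ∈ s, x l ∈ p → ∀ l ∈ s, x l ∈ p := by
    intro s
    induction s using Finset.induction_on with
    | empty => simp
    | insert m s hm ih =>
      intro x hx hsum
      have h1 : ∑ l ∈ s, ((l : K) - m) • x l ∈ p := by
        have h2 := p.sub_mem (hp _ hsum) (p.smul_mem (m : K) hsum)
        rw [Finset.sum_insert hm, map_add, map_sum, smul_add, Finset.smul_sum, hx m,
          add_sub_add_left_eq_sub, ← Finset.sum_sub_distrib] at h2
        simpa only [hx, ← sub_smul] using h2
      have h3 : ∀ l ∈ s, x l ∈ p := by
        intro l hl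
        have hlm : ((l : K) - m) ≠ 0 := by
          rw [sub_ne_zero]
          exact fun h => hm (Int.cast_injective h ▸ hl)
        have := ih (fun l => ((l : K) - m) • x l)
          (fun l => by rw [map_smul, hx, smul_comm]) h1 l hl
        exact (p.smul_mem_iff hlm).1 this
      intro l hl
      rcases Finset.mem_insert.1 hl with rfl | hl
      · rw [Finset.sum_insert hm] at hsum
        exact (p.add_mem_iff_left (p.sum_mem h3)).1 hsum
      · exact h3 l hl
  obtain ⟨s, hs, hsum⟩ := exists_sum hD v
  by_cases hn : n ∈ s
  · exact key s (fun l => proj hD l v) (fun l => mem_eigen.1 (proj_mem hD l v)) (hsum ▸ hv) n hn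
  · rw [hs n hn]
    exact p.zero_mem

variable {U : ℤ → Submodule K V} (hU : DirectSum.IsInternal U)

lemma leading_term {D E : V →ₗ[K] V} (hE : ∀ n, ∀ x ∈ U n, E x ∈ U n)
    (hDE : ∀ n, ∀ x ∈ U n, D x - E x ∈ filt hU (n + 1)) {n : ℤ} {w : V} (hw : w ∈ filt hU n) :
    D w ∈ filt hU n ∧ proj hU n (D w) = E (proj hU n w) := by
  have h1 : (D - E) w ∈ filt hU (n + 1) :=
    map_filt hU hU (D - E) 1 n (fun i _ x hx => by simpa using hDE i x hx) hw
  have h2 : E w ∈ filt hU (n + 0) :=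
    map_filt hU hU E 0 n (fun i _ x hx => by
      simpa using mem_filt_of_mem hU (hE i x hx) le_rfl) hw
  have h3 := proj_map hU hU E 0 (fun n x hx => by simpa using hE n x hx) n w
  rw [add_zero] at h2 h3
  have h4 : D w = (D - E) w + E w := by simp
  rw [h4]
  refine ⟨Submodule.add_mem _ (filt_anti hU (by omega) h1) h2, ?_⟩
  rw [map_add, (mem_filt hU).1 h1 n (by omega), zero_add, h3]

/-- Every homogeneous subspace is spanned by the leading terms of eigenvectors of `D`. -/
lemma le_of_leading_terms [CharZero K] {D : V →ₗ[K] V}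
    (hF : ∀ n, ∀ x ∈ filt hU n, D x ∈ filt hU n) (hD : DirectSum.IsInternal (eigen D))
    {n : ℤ} {Q : Submodule K V}
    (hQ : ∀ l : ℤ, ∀ w ∈ filt hU n, w ∈ eigen D l → proj hU n w ∈ Q) : U n ≤ Q := by
  intro v hv
  obtain ⟨s, -, hs⟩ := exists_sum hD v
  rw [← proj_of_mem hU hv, hs, map_sum]
  refine Q.sum_mem fun l _ => hQ l _ ?_ (proj_mem hD l v)
  exact proj_eigen_mem hD (hF n) (mem_filt_of_mem hU hv le_rfl) l

lemma eq_zero_of_raising {φ : V →ₗ[K] V} (hφ : ∀ n, ∀ x ∈ U n, φ x ∈ filt hU (n + 1)) {c : K}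
    {z : V} (hz : φ z = c • z) : φ z = 0 := by
  by_cases hc : c = 0
  · rw [hz, hc, zero_smul]
  · have : z = 0 := eq_zero_of_step hU fun n hn => by
      have := map_filt hU hU φ 1 n (fun i _ => hφ i) hn
      rw [hz] at this
      exact (Submodule.smul_mem_iff _ hc).1 this
    rw [this, map_zero]

lemma bilin_filt {β : V →ₗ[K] V →ₗ[K] V} {k : ℤ}
    (hβ : ∀ m n, ∀ x ∈ U m, ∀ y ∈ U n, β x y ∈ U (m + n + k)) {m n : ℤ} {x y : V}
    (hx : x ∈ filt hU m) (hy : y ∈ filt hU n) : β x y ∈ filt hU (m + n + k) := by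
  have h1 : ∀ i, ∀ x ∈ U i, β x y ∈ filt hU (i + (n + k)) := by
    intro i x hx
    have := map_filt hU hU (β x) (i + k) n (fun j _ z hz =>
      mem_filt_of_mem hU (hβ i j x hx z hz) (by omega)) hy
    rwa [show n + (i + k) = i + (n + k) by ring] at this
  have := map_filt hU hU (β.flip y) (n + k) m (fun i _ x hx => h1 i x hx) hx
  rwa [← add_assoc] at this

lemma proj_bilin {β : V →ₗ[K] V →ₗ[K] V} {k : ℤ}
    (hβ : ∀ m n, ∀ x ∈ U m, ∀ y ∈ U n, β x y ∈ U (m + n + k)) {m n : ℤ} {x y : V}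
    (hx : x ∈ filt hU m) (hy : y ∈ filt hU n) :
    proj hU (m + n + k) (β x y) = β (proj hU m x) (proj hU n y) := by
  have h1 := bilin_filt hU hβ (sub_proj_mem_filt hU hx) hy
  have h2 := bilin_filt hU hβ (mem_filt_of_mem hU (proj_mem hU m x) le_rfl)
    (sub_proj_mem_filt hU hy)
  have h3 : β x y = β (x - proj hU m x) y + β (proj hU m x) (y - proj hU n y)
      + β (proj hU m x) (proj hU n y) := by simp
  rw [h3, map_add, map_add, (mem_filt hU).1 h1 _ (by omega), (mem_filt hU).1 h2 _ (by omega),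
    proj_of_mem hU (hβ m n _ (proj_mem hU m x) _ (proj_mem hU n y))]
  simp

lemma stable_filt {D : V →ₗ[K] V}
    (hD' : ∀ n : ℤ, ∀ x ∈ U n, D x - (n : K) • x ∈ filt hU (n + 1)) {n : ℤ} {w : V}
    (hw : w ∈ filt hU n) : D w ∈ filt hU n := by
  simpa using map_filt hU hU D 0 n (fun i _ x hx => by
    have h := Submodule.add_mem _ (filt_anti hU (by omega : i + 0 ≤ i + 1) (hD' i x hx))
      (Submodule.smul_mem _ (i : K) (mem_filt_of_mem hU hx (by omega : i + 0 ≤ i)))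
    simpa using h) hw

lemma eigen_mem_filt [CharZero K] {D : V →ₗ[K] V}
    (hD' : ∀ n : ℤ, ∀ x ∈ U n, D x - (n : K) • x ∈ filt hU (n + 1)) {l : ℤ} {w : V}
    (hw : w ∈ eigen D l) {n : ℤ} (hn : w ∈ filt hU n) (hnl : n ≠ l) : w ∈ filt hU (n + 1) := by
  have h1 : (D - (n : K) • (LinearMap.id : V →ₗ[K] V)) w ∈ filt hU (n + 1) := by
    have h2 : (D - (n : K) • (LinearMap.id : V →ₗ[K] V)) (w - proj hU n w) ∈ filt hU (n + 1) := by
      have h4 := sub_proj_mem_filt hU hn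
      simpa using Submodule.sub_mem _ (stable_filt hU hD' h4) (Submodule.smul_mem _ (n : K) h4)
    have h3 := Submodule.add_mem _ h2 (hD' n _ (proj_mem hU n w))
    convert h3 using 1
    simp only [LinearMap.sub_apply, LinearMap.smul_apply, LinearMap.id_apply, map_sub]
    abel
  have h2 : (D - (n : K) • (LinearMap.id : V →ₗ[K] V)) w = ((l : K) - n) • w := by
    simp [mem_eigen.1 hw, sub_smul]
  rw [h2] at h1
  refine (Submodule.smul_mem_iff _ ?_).1 h1
  rw [sub_ne_zero]
  exact fun h => hnl (Int.cast_injective h).symm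

/-- If `D` is diagonalizable and differs from the degree operator of a grading by terms raising
the degree, then taking leading terms of eigenvectors of `D` is an automorphism compatible with
all homogeneous products. -/
theorem exists_leading_term_equiv [CharZero K] {D : V →ₗ[K] V}
    (hD' : ∀ n : ℤ, ∀ x ∈ U n, D x - (n : K) • x ∈ filt hU (n + 1))
    (hD : DirectSum.IsInternal (eigen D)) :
    ∃ g : V →ₗ[K] V, Function.Bijective g ∧ (∀ n, ∀ w ∈ eigen D n, g w = proj hU n w) ∧
      (∀ n, ∀ w ∈ eigen D n, w ∈ U n → g w = w) ∧
      ∀ (β : V →ₗ[K] V →ₗ[K] V) (k : ℤ),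
        (∀ m n, ∀ x ∈ U m, ∀ y ∈ U n, β x y ∈ U (m + n + k)) →
        (∀ m n, ∀ x ∈ eigen D m, ∀ y ∈ eigen D n, β x y ∈ eigen D (m + n + k)) →
        ∀ x y, g (β x y) = β (g x) (g y) := by
  let g : V →ₗ[K] V := DirectSum.toModule K ℤ V (fun n => proj hU n ∘ₗ (eigen D n).subtype) ∘ₗ
    (decomp hD).toLinearMap
  have hg : ∀ n, ∀ w ∈ eigen D n, g w = proj hU n w := by
    intro n w hw
    simp only [g, LinearMap.comp_apply, LinearEquiv.coe_coe, decomp_of_mem hD hw,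
      DirectSum.toModule_lof, Submodule.subtype_apply]
  have hfilt : ∀ n, ∀ w ∈ eigen D n, w ∈ filt hU n := fun n w hw =>
    mem_filt_of_step hU n fun i hi h => eigen_mem_filt hU hD' hw h hi.ne
  refine ⟨g, ⟨?_, ?_⟩, hg, fun n w hw hw' => by rw [hg n w hw, proj_of_mem hU hw'], ?_⟩
  · rw [injective_iff_map_eq_zero]
    intro v hv
    refine eq_zero_of_proj hD fun n => ?_
    have h1 := proj_map hD hU g 0 (fun n x hx => by
      rw [hg n x hx, add_zero]; exact proj_mem hU n x) n v
    rw [hv, map_zero, hg n _ (proj_mem hD n v)] at h1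
    refine eq_zero_of_step hU fun i hi => ?_
    by_cases hin : i = n
    · subst hin
      exact filt_succ_of_proj hU hi h1.symm
    · exact eigen_mem_filt hU hD' (proj_mem hD n v) hi hin
  · rw [← LinearMap.range_eq_top, eq_top_iff, ← iSup_eq_top hU]
    refine iSup_le fun n => ?_
    refine le_of_leading_terms hU (fun m x hx => stable_filt hU hD' hx) hD fun l w hw hwl => ?_
    rcases eq_or_ne n l with rfl | hnl
    · exact ⟨w, hg n w hwl⟩
    · rw [(mem_filt hU).1 (eigen_mem_filt hU hD' hwl hw hnl) n (by omega)]
      exact Submodule.zero_mem _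
  · intro β k hβ hβ' x y
    refine induction_on hD x (fun m x hx => ?_) (by simp) fun x y hx hy => by simp [hx, hy]
    refine induction_on hD y (fun n y hy => ?_) (by simp) fun x y hx hy => by simp [hx, hy]
    rw [hg _ _ (hβ' m n x hx y hy), hg _ _ hx, hg _ _ hy,
      proj_bilin hU hβ (hfilt _ _ hx) (hfilt _ _ hy)]

end Operator

end InternalGrading

section ZBinom

variable (K : Type*) [Field K]

@[simp]
lemma zBinom_zero_right (m : ℤ) : zBinom K m 0 = 1 := by simp [zBinom]

@[simp]
lemma zBinom_one_right (m : ℤ) : zBinom K m 1 = m := by simp [zBinom]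

lemma zBinom_eq_zero {m i : ℕ} (h : m < i) : zBinom K m i = 0 := by
  rw [zBinom, Finset.prod_eq_zero (Finset.mem_range.2 h) (by simp), zero_div]

lemma zBinom_zero_left {i : ℕ} (h : i ≠ 0) : zBinom K 0 i = 0 :=
  zBinom_eq_zero K (m := 0) (Nat.pos_of_ne_zero h)

lemma zBinom_neg_one [CharZero K] (i : ℕ) : zBinom K (-1) i = (-1) ^ i := by
  rw [zBinom, div_eq_iff (by exact_mod_cast i.factorial_ne_zero)]
  induction i with
  | zero => simp
  | succ i ih =>
    rw [Finset.prod_range_succ, ih, Nat.factorial_succ]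
    push_cast
    ring

lemma zBinom_neg_two [CharZero K] (i : ℕ) : zBinom K (-2) i = (-1) ^ i * (i + 1) := by
  rw [zBinom, div_eq_iff (by exact_mod_cast i.factorial_ne_zero)]
  induction i with
  | zero => simp
  | succ i ih =>
    rw [Finset.prod_range_succ, ih, Nat.factorial_succ]
    push_cast
    ring

end ZBinom

namespace VA

variable {K V : Type*} [Field K] [AddCommGroup V] [Module K V] (A : VA K V)

lemma commutator_formula (k : ℕ) (q : ℤ) (a b c : V) :
    A.ncoef k a (A.ncoef q b c) - A.ncoef q b (A.ncoef k a c) =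
      ∑ i ∈ Finset.range (k + 1), zBinom K k i • A.ncoef (k + q - i) (A.ncoef i a b) c := by
  have h := A.borcherds a b c 0 q k
  rw [finsum_eq_sum_of_support_subset (s := Finset.range (k + 1)),
    finsum_eq_single _ 0 (fun i hi => by rw [zBinom_zero_left K hi]; simp)] at h
  · simp only [zero_add] at h
    rw [h]
    simp
  · intro i hi
    by_contra hik
    rw [Finset.coe_range, Set.mem_Iio, not_lt] at hik
    exact hi (by simp [zBinom_eq_zero K (show k < i by omega)])

lemma commutator_zero (q : ℤ) (a b c : V) :
    A.ncoef 0 a (A.ncoef q b c) - A.ncoef q b (A.ncoef 0 a c) = A.ncoef q (A.ncoef 0 a b) c := by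
  simpa using A.commutator_formula 0 q a b c

lemma commutator_one (q : ℤ) (a b c : V) :
    A.ncoef 1 a (A.ncoef q b c) - A.ncoef q b (A.ncoef 1 a c) =
      A.ncoef (q + 1) (A.ncoef 0 a b) c + A.ncoef q (A.ncoef 1 a b) c := by
  have h := A.commutator_formula 1 q a b c
  simp only [Finset.sum_range_succ, Finset.sum_range_zero, Nat.cast_one, Nat.cast_zero,
    zBinom_zero_right, zBinom_one_right, zero_add, Int.cast_one, one_smul, sub_zero] at h
  rw [h, show (1 : ℤ) + q - 1 = q by ring, add_comm 1 q]

lemma commutator_two [CharZero K] (q : ℤ) (a b c : V) :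
    A.ncoef 2 a (A.ncoef q b c) - A.ncoef q b (A.ncoef 2 a c) =
      A.ncoef (q + 2) (A.ncoef 0 a b) c + (2 : K) • A.ncoef (q + 1) (A.ncoef 1 a b) c
        + A.ncoef q (A.ncoef 2 a b) c := by
  have h := A.commutator_formula 2 q a b c
  have h2 : zBinom K 2 2 = 1 := by
    simp [zBinom, Finset.prod_range_succ]; norm_num
  simp only [Finset.sum_range_succ, Finset.sum_range_zero, Nat.cast_one, Nat.cast_zero,
    zBinom_zero_right, zBinom_one_right, zero_add, Nat.cast_ofNat, one_smul, sub_zero, h2,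
    Int.cast_ofNat] at h
  rw [h, show (2 : ℤ) + q - 2 = q by ring, show (2 : ℤ) + q - 1 = q + 1 by ring, add_comm 2 q]

lemma T_apply (v : V) : A.T v = A.ncoef (-2) v A.vac := rfl

@[simp]
lemma T_vac : A.T A.vac = 0 := by simp [T_apply, vac_ncoef]

lemma T_ncoef [CharZero K] (n : ℤ) (v c : V) :
    A.ncoef n (A.T v) c = -(n : K) • A.ncoef (n - 1) v c := by
  have h := A.borcherds v A.vac c (-2) n 0
  rw [finsum_eq_single _ 0 (fun i hi => by rw [zBinom_zero_left K hi, zero_smul])] at h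
  simp only [zBinom_zero_right, zBinom_neg_two, one_smul, Nat.cast_zero, add_zero, sub_zero,
    zero_add, vac_ncoef] at h
  rw [T_apply, h]
  rcases lt_trichotomy n 0 with hn | rfl | hn
  · obtain ⟨k, rfl⟩ : ∃ k : ℕ, n = -1 - k := ⟨(-1 - n).toNat, by omega⟩
    rw [finsum_eq_single _ k]
    · rw [if_pos (by ring), if_neg (by omega), smul_zero, sub_zero, ← mul_assoc, ← mul_pow,
        show -1 - (k : ℤ) - 1 = -2 - k by ring]
      congr 1
      push_cast
      ring
    · intro i hi
      rw [if_neg (by omega), if_neg (by omega)]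
      simp
  · rw [finsum_eq_zero_of_forall_eq_zero]
    · simp
    · intro i
      rw [if_neg (by omega), if_neg (by omega)]
      simp
  · obtain ⟨k, rfl⟩ : ∃ k : ℕ, n = k + 1 := ⟨(n - 1).toNat, by omega⟩
    rw [finsum_eq_single _ k]
    · rw [if_neg (by omega), if_pos (by ring), map_zero, zero_sub, ← mul_assoc, ← mul_pow,
        show (k : ℤ) + 1 - 1 = k by ring]
      simp [smul_neg, ← neg_smul]
    · intro i hi
      rw [if_neg (by omega), if_neg (by omega)]
      simp

lemma skew_symmetry [CharZero K] (p : ℤ) (a b : V) :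
    ∃ N₀ : ℕ, ∀ N ≥ N₀, A.ncoef p b a = -((p.negOnePow : ℤ) : K) •
      ∑ i ∈ Finset.range N, (-1 : K) ^ i • A.ncoef (-1 - i) (A.ncoef (p + i) a b) A.vac := by
  obtain ⟨M, hM⟩ := A.trunc a b
  refine ⟨(M - p).toNat, fun N hN => ?_⟩
  have h := A.borcherds a b A.vac p 0 (-1)
  rw [finsum_eq_sum_of_support_subset (s := Finset.range N), finsum_eq_single _ 0] at h
  · simp only [zBinom_neg_one, zBinom_zero_right, Nat.cast_zero, add_zero, sub_zero,
      A.ncoef_vac_zero 0 le_rfl, map_zero, pow_zero, one_mul, one_smul, zero_sub,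
      A.ncoef_vac] at h
    rw [h, neg_smul, smul_neg, neg_neg, smul_smul]
    rcases p.even_or_odd with hp | hp
    · simp [Int.negOnePow_even p hp]
    · simp [Int.negOnePow_odd p hp]
  · intro i hi
    rw [A.ncoef_vac_zero _ (by omega), A.ncoef_vac_zero _ (by omega)]
    simp
  · intro i hi
    by_contra hiN
    rw [Finset.coe_range, Set.mem_Iio, not_lt] at hiN
    exact hi (by simp [hM (p + i) (by omega)])

variable {A}

lemma T_comm {e : V} (he : A.ncoef 0 e = A.T) (n : ℤ) [CharZero K] (a b : V) :
    A.T (A.ncoef n a b) = A.ncoef n a (A.T b) - (n : K) • A.ncoef (n - 1) a b := by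
  have h := A.commutator_zero n e a b
  rw [he, A.T_ncoef] at h
  rw [sub_eq_iff_eq_add.1 h, neg_smul]
  abel

lemma ncoef_vac_succ {e : V} (he : A.ncoef 0 e = A.T) [CharZero K] (i : ℕ) (x : V) :
    A.ncoef (-1 - (i + 1 : ℕ)) x A.vac = ((i : K) + 1)⁻¹ • A.T (A.ncoef (-1 - i) x A.vac) := by
  rw [T_comm he, T_vac, map_zero, zero_sub, ← neg_smul, smul_smul, eq_comm]
  convert one_smul K _ using 2
  · have : (i : K) + 1 ≠ 0 := by exact_mod_cast i.succ_ne_zero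
    push_cast
    field_simp
    ring
  · push_cast
    rw [show -1 - ((i : ℤ) + 1) = -1 - i - 1 by ring]

lemma skew_symmetry_mem [CharZero K] {e : V} (he : A.ncoef 0 e = A.T) {I : Submodule K V}
    (hT : ∀ x ∈ I, A.T x ∈ I) {a b : V} (h : ∀ n, A.ncoef n a b ∈ I) (p : ℤ) :
    A.ncoef p b a ∈ I := by
  have hv : ∀ (i : ℕ), ∀ x ∈ I, A.ncoef (-1 - i) x A.vac ∈ I := by
    intro i
    induction i with
    | zero => intro x hx; simpa [A.ncoef_vac] using hx
    | succ i ih =>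
      intro x hx
      rw [ncoef_vac_succ he]
      exact I.smul_mem _ (hT _ (ih x hx))
  obtain ⟨N, hN⟩ := A.skew_symmetry p a b
  rw [hN N le_rfl]
  exact I.smul_mem _ (I.sum_mem fun i _ => I.smul_mem _ (hv i _ (h _)))

/-- Skew-symmetry up to second order in the translation operator. -/
lemma exists_skew_symmetry [CharZero K] {e : V} (he : A.ncoef 0 e = A.T) (p : ℤ) (a b : V) :
    ∃ z, A.ncoef p b a = -((p.negOnePow : ℤ) : K) •
      (A.ncoef p a b - A.T (A.ncoef (p + 1) a b) + A.T (A.T z)) := by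
  have hv : ∀ (i : ℕ) (x : V), ∃ z, A.ncoef (-1 - (i + 2 : ℕ)) x A.vac = A.T (A.T z) := by
    intro i x
    refine ⟨((i : K) + 2)⁻¹ • ((i : K) + 1)⁻¹ • A.ncoef (-1 - i) x A.vac, ?_⟩
    rw [ncoef_vac_succ he (i + 1), ncoef_vac_succ he i, map_smul, map_smul, map_smul, map_smul,
      map_smul]
    push_cast
    rw [add_assoc, one_add_one_eq_two]
  choose z hz using hv
  obtain ⟨N, hN⟩ := A.skew_symmetry p a b
  refine ⟨∑ i ∈ Finset.range N, (-1 : K) ^ i • z i (A.ncoef (p + (i + 2 : ℕ)) a b), ?_⟩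
  rw [hN (N + 2) (by omega), Finset.sum_range_succ', Finset.sum_range_succ']
  congr 1
  have h1 := ncoef_vac_succ he 0 (A.ncoef (p + 1) a b)
  simp only [Nat.cast_zero, sub_zero, zero_add, inv_one, one_smul, A.ncoef_vac] at h1
  simp only [zero_add, Nat.cast_one, pow_one, pow_zero, one_smul, Nat.cast_zero, sub_zero,
    add_zero, A.ncoef_vac, neg_smul, map_sum, map_smul]
  rw [Nat.cast_one] at h1
  rw [h1]
  have h2 : ∀ i ∈ Finset.range N, (-1 : K) ^ (i + 1 + 1) •
      A.ncoef (-1 - (i + 1 + 1 : ℕ)) (A.ncoef (p + (i + 1 + 1 : ℕ)) a b) A.vac =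
      (-1 : K) ^ i • A.T (A.T (z i (A.ncoef (p + (i + 2 : ℕ)) a b))) := by
    intro i _
    rw [← hz, pow_succ, pow_succ]
    simp [add_assoc, one_add_one_eq_two]
  rw [Finset.sum_congr rfl h2]
  abel

end VA

namespace VA

open InternalGrading

variable {K V : Type*} [Field K] [AddCommGroup V] [Module K V] {A : VA K V}

lemma mem_eig {e : V} {n : ℤ} {v : V} : v ∈ A.eig e n ↔ A.ncoef 1 e v = (n : K) • v :=
  mem_eigen

lemma eig_eq_eigen (e : V) : A.eig e = eigen (A.ncoef 1 e) := rfl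

lemma vac_ncoef_of_ne {n : ℤ} (hn : n ≠ -1) : A.ncoef n A.vac = 0 := by
  ext x
  simp [A.vac_ncoef, hn]

lemma vac_mem_eig (e : V) : A.vac ∈ A.eig e 0 := by
  simp [mem_eig, A.ncoef_vac_zero 1 one_pos.le]

/-- The defining properties of a conformal vector of CFT type that only involve its first two
products and the positivity of the induced grading. -/
structure IsCFTGrading (A : VA K V) (e : V) : Prop where
  zero_eq_T : A.ncoef 0 e = A.T
  internal : DirectSum.IsInternal (A.eig e)
  eig_neg : ∀ n : ℤ, n < 0 → A.eig e n = ⊥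
  eig_zero : A.eig e 0 = Submodule.span K {A.vac}
  self_mem : e ∈ A.eig e 2

lemma IsConformalCFT.isCFTGrading {e : V} (h : A.IsConformalCFT e) : A.IsCFTGrading e where
  zero_eq_T := h.1.2.2.2.2.1
  internal := h.1.2.2.2.2.2
  eig_neg := h.2.1
  eig_zero := h.2.2.2
  self_mem := by rw [mem_eig, h.1.1]; simp

namespace IsCFTGrading

variable {e : V} (G : A.IsCFTGrading e)

include G

lemma T_eq_zero_of_mem {v : V} (hv : v ∈ A.eig e 0) : A.T v = 0 := by
  rw [G.eig_zero, Submodule.mem_span_singleton] at hv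
  obtain ⟨c, rfl⟩ := hv
  simp

lemma proj_neg {n : ℤ} (hn : n < 0) (v : V) : proj G.internal n v = 0 := by
  have h := proj_mem G.internal n v
  rwa [G.eig_neg n hn, Submodule.mem_bot] at h

lemma eq_of_mem {n : ℤ} {x y : V} (hx : x ∈ A.eig e n) (h : x = y) :
    x = proj G.internal n y := by
  rw [← h, proj_of_mem _ hx]

lemma mem_filt_zero (v : V) : v ∈ filt G.internal 0 :=
  (mem_filt G.internal).2 fun _ hi => G.proj_neg hi v

end IsCFTGrading

variable [CharZero K]

lemma T_ncoef_zero (v : V) : A.ncoef 0 (A.T v) = 0 := by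
  ext x
  simp [T_ncoef]

lemma T_ncoef_one (v : V) : A.ncoef 1 (A.T v) = -A.ncoef 0 v := by
  ext x
  simp [T_ncoef]

lemma ncoef_mem_eig {e : V} (he : A.ncoef 0 e = A.T) (k m n : ℤ) {x y : V}
    (hx : x ∈ A.eig e m) (hy : y ∈ A.eig e n) : A.ncoef k x y ∈ A.eig e (m + n + (-k - 1)) := by
  rw [mem_eig] at *
  have h := A.commutator_one k e x y
  rw [he, A.T_ncoef, hx, hy, sub_eq_iff_eq_add] at h
  rw [h]
  simp only [map_smul, LinearMap.smul_apply, ← add_smul, add_sub_cancel_right]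
  congr 1
  push_cast
  ring

lemma T_mem_eig {e : V} (he : A.ncoef 0 e = A.T) {n : ℤ} {x : V} (hx : x ∈ A.eig e n) :
    A.T x ∈ A.eig e (n + 1) := by
  have h := ncoef_mem_eig he (-2) n 0 hx (vac_mem_eig e)
  rwa [show n + 0 + (-(-2) - 1) = n + 1 by ring] at h

lemma proj_T {e : V} (he : A.ncoef 0 e = A.T) (hi : DirectSum.IsInternal (A.eig e)) (n : ℤ)
    (v : V) : proj hi (n + 1) (A.T v) = A.T (proj hi n v) :=
  proj_map hi hi A.T 1 (fun _ _ hx => T_mem_eig he hx) n v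

namespace IsCFTGrading

variable {e : V} (G : A.IsCFTGrading e)

include G

lemma proj_T_of_nonpos {n : ℤ} (hn : n ≤ 1) (v : V) : proj G.internal n (A.T v) = 0 := by
  have h := proj_T G.zero_eq_T G.internal (n - 1) v
  rw [sub_add_cancel] at h
  rw [h]
  rcases lt_or_eq_of_le hn with hn | rfl
  · rw [G.proj_neg (by omega), map_zero]
  · exact G.T_eq_zero_of_mem (proj_mem G.internal _ v)

lemma proj_T_T {n : ℤ} (hn : n ≤ 2) (v : V) : proj G.internal n (A.T (A.T v)) = 0 := by
  have h := proj_T G.zero_eq_T G.internal (n - 1) (A.T v)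
  rw [sub_add_cancel] at h
  rw [h, G.proj_T_of_nonpos (by omega), map_zero]

lemma mem_span_vac_of_T_eq_zero {v : V} (hv : A.T v = 0) : v ∈ Submodule.span K {A.vac} := by
  rw [← G.eig_zero, mem_eig, Int.cast_zero, zero_smul]
  have hn : ∀ n : ℤ, n ≠ -1 → ∀ x, A.ncoef n v x = 0 := by
    intro n hn x
    have h := A.T_ncoef (n + 1) v x
    rw [hv, map_zero, LinearMap.zero_apply, add_sub_cancel_right, eq_comm, smul_eq_zero] at h
    refine h.resolve_left ?_
    rw [neg_eq_zero]
    exact_mod_cast (by omega : n + 1 ≠ 0)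
  obtain ⟨N, hN⟩ := A.skew_symmetry 1 v e
  rw [hN N le_rfl, Finset.sum_eq_zero fun i _ => by rw [hn _ (by omega)]; simp, smul_zero]

lemma skew_zero (a b : V) :
    ∃ z, A.ncoef 0 b a = -A.ncoef 0 a b + A.T (A.ncoef 1 a b) - A.T (A.T z) := by
  obtain ⟨z, hz⟩ := A.exists_skew_symmetry G.zero_eq_T 0 a b
  refine ⟨z, ?_⟩
  rw [hz]
  simp only [Int.negOnePow_zero, Units.val_one, Int.cast_one, zero_add]
  module

lemma skew_one (a b : V) :
    ∃ z, A.ncoef 1 b a = A.ncoef 1 a b - A.T (A.ncoef 2 a b) + A.T (A.T z) := by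
  obtain ⟨z, hz⟩ := A.exists_skew_symmetry G.zero_eq_T 1 a b
  refine ⟨z, ?_⟩
  rw [hz]
  simp only [Int.negOnePow_one, Units.val_neg, Units.val_one, Int.cast_neg, Int.cast_one, neg_neg,
    one_smul]
  rfl

/-- A vector with vanishing zeroth product is, up to derivatives and the vacuum, homogeneous of
degree one. -/
lemma exists_sub_eq_of_ncoef_zero {v : V} (hv : A.ncoef 0 v = 0) :
    ∃ y, ∃ k : K, v - A.ncoef 1 e v = A.T y + k • A.vac := by
  obtain ⟨z, hz⟩ := G.skew_zero v e
  obtain ⟨z', hz'⟩ := G.skew_one e v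
  rw [G.zero_eq_T, hv, hz', LinearMap.zero_apply, neg_zero, zero_add] at hz
  have h : A.T (v - A.ncoef 1 e v - A.T (-A.ncoef 2 e v + A.T z' - z)) = 0 := by
    rw [← sub_eq_zero] at hz
    rw [← hz]
    simp only [map_sub, map_add, map_neg]
    abel
  obtain ⟨k, hk⟩ := Submodule.mem_span_singleton.1 (G.mem_span_vac_of_T_eq_zero h)
  exact ⟨_, k, by rw [hk]; abel⟩

end IsCFTGrading
end VA

namespace VA

open InternalGrading

variable {K V : Type*} [Field K] [AddCommGroup V] [Module K V] {A : VA K V} {f g : V → V}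

/-- A vertex algebra homomorphism as a linear map. -/
def IsVAHom.toLinearMap (hf : A.IsVAHom f) : V →ₗ[K] V where
  toFun := f
  map_add' := hf.map_add
  map_smul' := hf.map_smul

lemma IsVAHom.map_T (hf : A.IsVAHom f) (v : V) : f (A.T v) = A.T (f v) := by
  rw [T_apply, hf.map_ncoef, hf.map_vac, T_apply]

lemma isVAAut_of_linearMap {φ : V →ₗ[K] V} (hb : Function.Bijective φ)
    (hφ : ∀ (n : ℤ) (a b : V), φ (A.ncoef n a b) = A.ncoef n (φ a) (φ b))
    (hvac : φ A.vac = A.vac) : A.IsVAAut φ :=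
  ⟨⟨map_add φ, map_smul φ, hφ, hvac⟩, hb⟩

namespace IsVAAut

lemma comp (hg : A.IsVAAut g) (hf : A.IsVAAut f) : A.IsVAAut (g ∘ f) where
  left :=
    { map_add := fun a b => by simp [hf.1.map_add, hg.1.map_add]
      map_smul := fun c a => by simp [hf.1.map_smul, hg.1.map_smul]
      map_ncoef := fun n a b => by simp [hf.1.map_ncoef, hg.1.map_ncoef]
      map_vac := by simp [hf.1.map_vac, hg.1.map_vac] }
  right := hg.2.comp hf.2

lemma exists_inverse (hf : A.IsVAAut f) : ∃ g, A.IsVAAut g ∧ ∀ v, g (f v) = v := by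
  obtain ⟨g, hgf, hfg⟩ := Function.bijective_iff_has_inverse.1 hf.2
  refine ⟨g, ⟨⟨fun a b => hf.2.1 ?_, fun c a => hf.2.1 ?_, fun n a b => hf.2.1 ?_, hf.2.1 ?_⟩,
    hfg.injective, hgf.surjective⟩, hgf⟩
  · rw [hf.1.map_add, hfg, hfg, hfg]
  · rw [hf.1.map_smul, hfg, hfg]
  · rw [hf.1.map_ncoef, hfg, hfg, hfg]
  · rw [hf.1.map_vac, hfg]

variable (hf : A.IsVAAut f)

include hf

lemma eig_map (a : V) (n : ℤ) : A.eig (f a) n = (A.eig a n).map hf.1.toLinearMap := by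
  ext v
  obtain ⟨w, rfl⟩ := hf.2.2 v
  rw [mem_eig, ← hf.1.map_ncoef, ← hf.1.map_smul, hf.2.1.eq_iff, ← mem_eig]
  exact (Function.Injective.mem_set_image (f := f) hf.2.1 (s := (A.eig a n : Set V))).symm

lemma map_mem_eig {a v : V} {n : ℤ} (hv : v ∈ A.eig a n) : f v ∈ A.eig (f a) n := by
  rw [hf.eig_map]
  exact Submodule.mem_map_of_mem (f := hf.1.toLinearMap) hv

lemma eig_zero_map {a : V} (ha : A.eig a 0 = Submodule.span K {A.vac}) :
    A.eig (f a) 0 = Submodule.span K {A.vac} := by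
  rw [hf.eig_map, ha, Submodule.map_span, Set.image_singleton]
  exact congrArg (fun v => Submodule.span K {v}) hf.1.map_vac

lemma zero_eq_T_map {a : V} (ha : A.ncoef 0 a = A.T) : A.ncoef 0 (f a) = A.T := by
  ext v
  obtain ⟨w, rfl⟩ := hf.2.2 v
  rw [← hf.1.map_ncoef, ha, hf.1.map_T]

lemma internal_map [CharZero K] {a : V} (ha : DirectSum.IsInternal (A.eig a)) :
    DirectSum.IsInternal (A.eig (f a)) := by
  rw [eig_eq_eigen, isInternal_eigen_iff] at *
  rw [← eig_eq_eigen] at *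
  simp_rw [hf.eig_map]
  rw [← Submodule.map_iSup, ha, Submodule.map_top, LinearMap.range_eq_top]
  exact hf.2.2

lemma isConformalCFT_map [CharZero K] {a : V} (ha : A.IsConformalCFT a) :
    A.IsConformalCFT (f a) := by
  obtain ⟨⟨h1, ⟨c, h3⟩, h2, h4, h0, hi⟩, hneg, hfd, hz⟩ := ha
  have h0' : f 0 = 0 := by simpa using hf.1.map_smul 0 0
  refine ⟨⟨?_, ⟨c, ?_⟩, ?_, fun n hn => ?_, hf.zero_eq_T_map h0, hf.internal_map hi⟩,
    fun n hn => ?_, fun n => ?_, hf.eig_zero_map hz⟩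
  · rw [← hf.1.map_ncoef, h1, hf.1.map_smul]
  · rw [← hf.1.map_ncoef, h3, hf.1.map_smul, hf.1.map_vac]
  · rw [← hf.1.map_ncoef, h2, h0']
  · rw [← hf.1.map_ncoef, h4 n hn, h0']
  · rw [hf.eig_map, hneg n hn, Submodule.map_bot]
  · have := hfd n
    rw [hf.eig_map]
    infer_instance

lemma isCFTGrading_map [CharZero K] {a : V} (ha : A.IsCFTGrading a) : A.IsCFTGrading (f a) where
  zero_eq_T := hf.zero_eq_T_map ha.zero_eq_T
  internal := hf.internal_map ha.internal
  eig_neg n hn := by rw [hf.eig_map, ha.eig_neg n hn, Submodule.map_bot]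
  eig_zero := hf.eig_zero_map ha.eig_zero
  self_mem := hf.map_mem_eig ha.self_mem

end IsVAAut
end VA

namespace VA

open InternalGrading

variable {K V : Type*} [Field K] [CharZero K] [AddCommGroup V] [Module K V] {A : VA K V}

lemma ncoef_zero_add_T {e : V} (he : A.ncoef 0 e = A.T) (h : V) :
    A.ncoef 0 (e + A.T h) = A.T := by
  rw [map_add, T_ncoef_zero, add_zero, he]

lemma ncoef_one_add_T (e h : V) : A.ncoef 1 (e + A.T h) = A.ncoef 1 e - A.ncoef 0 h := by
  rw [map_add, T_ncoef_one, sub_eq_add_neg]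

namespace IsCFTGrading

variable {ω : V} (G : A.IsCFTGrading ω)

include G

lemma ncoef_zero_filt {w x : V} {m n : ℤ} (hw : w ∈ filt G.internal (m + 1))
    (hx : x ∈ filt G.internal n) : A.ncoef 0 w x ∈ filt G.internal (n + m) := by
  have h := bilin_filt G.internal (fun i j y hy z hz => ncoef_mem_eig G.zero_eq_T 0 i j hy hz) hw hx
  rwa [show m + 1 + n + (-0 - 1) = n + m by ring] at h

lemma ncoef_zero_mem {w x : V} {n : ℤ} (hw : w ∈ A.eig ω 1) (hx : x ∈ A.eig ω n) :
    A.ncoef 0 w x ∈ A.eig ω n := by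
  have h := ncoef_mem_eig G.zero_eq_T 0 1 n hw hx
  rwa [show 1 + n + (-0 - 1) = n by ring] at h

lemma ncoef_zero_conformal {h : V} (hh : h ∈ A.eig ω 1) : A.ncoef 0 h ω = 0 := by
  obtain ⟨z, hz⟩ := G.skew_zero ω h
  rw [G.zero_eq_T, mem_eig.1 hh, Int.cast_one, one_smul, neg_add_cancel, zero_sub] at hz
  rw [G.eq_of_mem (G.ncoef_zero_mem hh G.self_mem) hz, map_neg, G.proj_T_T le_rfl, neg_zero]

lemma ncoef_zero_self {h : V} (hh : h ∈ A.eig ω 1) : A.ncoef 0 h h = 0 := by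
  obtain ⟨z, hz⟩ := G.skew_zero h h
  have hm := G.ncoef_zero_mem hh hh
  have h2 := G.eq_of_mem hm hz
  rw [map_sub, map_add, map_neg, G.proj_T_of_nonpos le_rfl, G.proj_T_of_nonpos le_rfl,
    proj_of_mem _ hm, add_zero, sub_zero] at h2
  rw [← sub_eq_zero, sub_neg_eq_add, ← two_smul K] at h2
  exact (smul_eq_zero.1 h2).resolve_left two_ne_zero

variable {h : V} (hh : h ∈ A.eig ω 1)

include hh

lemma ncoef_zero_T_self : A.ncoef 0 h (A.T h) = 0 := by
  have := T_comm G.zero_eq_T 0 h h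
  rw [G.ncoef_zero_self hh, map_zero, Int.cast_zero, zero_smul, sub_zero] at this
  exact this.symm

lemma add_T_self_mem_eig : ω + A.T h ∈ A.eig (ω + A.T h) 2 := by
  rw [mem_eig, ncoef_one_add_T, LinearMap.sub_apply, map_add, map_add, G.ncoef_zero_conformal hh,
    G.ncoef_zero_T_self hh, add_zero, sub_zero, smul_add, mem_eig.1 G.self_mem,
    mem_eig.1 (T_mem_eig G.zero_eq_T hh)]
  norm_num

lemma add_T_mem_eig_two : ω + A.T h ∈ A.eig ω 2 := by
  have h2 := T_mem_eig G.zero_eq_T hh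
  rw [one_add_one_eq_two] at h2
  exact Submodule.add_mem _ G.self_mem h2

lemma mem_eig_add_T : h ∈ A.eig (ω + A.T h) 1 := by
  rw [mem_eig, ncoef_one_add_T, LinearMap.sub_apply, G.ncoef_zero_self hh, sub_zero,
    mem_eig.1 hh]

lemma ncoef_one_add_T_mem {n : ℤ} {x : V} (hx : x ∈ A.eig ω n) :
    A.ncoef 1 (ω + A.T h) x ∈ A.eig ω n := by
  rw [ncoef_one_add_T, LinearMap.sub_apply, mem_eig.1 hx]
  exact Submodule.sub_mem _ (Submodule.smul_mem _ _ hx) (G.ncoef_zero_mem hh hx)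

lemma ncoef_one_add_T_filt {n : ℤ} {x : V} (hx : x ∈ filt G.internal n) :
    A.ncoef 1 (ω + A.T h) x ∈ filt G.internal n := by
  have := map_filt G.internal G.internal (A.ncoef 1 (ω + A.T h)) 0 n (fun i _ y hy => by
    rw [add_zero]; exact mem_filt_of_mem _ (G.ncoef_one_add_T_mem hh hy) le_rfl) hx
  rwa [add_zero] at this

variable {r : V} (hr : r ∈ filt G.internal 2) (Ga : A.IsCFTGrading (ω + A.T h + A.T r))

include hr Ga

lemma eig_le_iSup {n : ℤ} (hn : 1 ≤ n) :
    A.eig ω n ≤ ⨆ l : {l : ℤ // 1 ≤ l}, A.eig ω n ⊓ A.eig (ω + A.T h) l := by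
  have key : ∀ m : ℤ, ∀ w ∈ filt G.internal m, _ := fun m w hw =>
    leading_term G.internal (D := A.ncoef 1 (ω + A.T h + A.T r)) (E := A.ncoef 1 (ω + A.T h))
      (fun _ _ => G.ncoef_one_add_T_mem hh) (fun i x hx => by
        rw [ncoef_one_add_T (ω + A.T h), LinearMap.sub_apply, sub_sub_cancel_left]
        exact Submodule.neg_mem _ (G.ncoef_zero_filt (by simpa using hr)
          (mem_filt_of_mem _ hx le_rfl))) hw
  refine le_of_leading_terms G.internal (fun m w hw => (key m w hw).1) Ga.internal
    fun l w hw hl => ?_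
  by_cases hl1 : 1 ≤ l
  · refine Submodule.mem_iSup_of_mem (⟨l, hl1⟩ : {l : ℤ // 1 ≤ l}) ⟨proj_mem _ _ _, ?_⟩
    change _ ∈ A.eig _ l
    rw [mem_eig, ← (key n w hw).2, mem_eigen.1 hl, map_smul]
  · have h0 : w ∈ A.eig ω 0 := by
      rw [← eig_eq_eigen] at hl
      rcases lt_or_eq_of_le (by omega : l ≤ 0) with hl0 | rfl
      · rw [Ga.eig_neg l hl0, Submodule.mem_bot] at hl
        rw [hl]
        exact Submodule.zero_mem _
      · rwa [Ga.eig_zero, ← G.eig_zero] at hl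
    rw [proj_of_mem_ne _ h0 (by omega)]
    exact Submodule.zero_mem _

/-- Truncating a conformal vector of the form `ω + T u` to its part of degree two again gives a
conformal vector of CFT type. -/
theorem isCFTGrading_add_T : A.IsCFTGrading (ω + A.T h) := by
  have hi : DirectSum.IsInternal (A.eig (ω + A.T h)) := by
    rw [eig_eq_eigen, isInternal_eigen_iff, eq_top_iff, ← iSup_eq_top G.internal, iSup_le_iff]
    intro n
    rcases lt_trichotomy n 0 with hn | rfl | hn
    · rw [G.eig_neg n hn]
      exact bot_le
    · rw [G.eig_zero, Submodule.span_singleton_le_iff_mem]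
      exact Submodule.mem_iSup_of_mem 0 (vac_mem_eig _)
    · refine (G.eig_le_iSup hh hr Ga hn).trans (iSup_le fun l => ?_)
      exact inf_le_right.trans (le_iSup (A.eig (ω + A.T h)) _)
  have hp : ∀ l ≤ 0, ∀ x, proj hi l x ∈ Submodule.span K {proj hi l A.vac} := by
    intro l hl
    suffices (⊤ : Submodule K V) ≤ (Submodule.span K {proj hi l A.vac}).comap (proj hi l) from
      fun x => this Submodule.mem_top
    rw [← iSup_eq_top G.internal, iSup_le_iff]
    intro n
    rcases lt_trichotomy n 0 with hn | rfl | hn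
    · rw [G.eig_neg n hn]
      exact bot_le
    · rw [G.eig_zero, Submodule.span_singleton_le_iff_mem]
      exact Submodule.mem_span_singleton_self _
    · refine (G.eig_le_iSup hh hr Ga hn).trans (iSup_le fun m x hx => ?_)
      have := m.2
      rw [Submodule.mem_comap, proj_of_mem_ne hi hx.2 (by omega)]
      exact Submodule.zero_mem _
  refine ⟨ncoef_zero_add_T G.zero_eq_T h, hi, fun l hl => ?_, le_antisymm (fun x hx => ?_) ?_,
    G.add_T_self_mem_eig hh⟩
  · rw [eq_bot_iff]
    intro x hx
    have := hp l hl.le x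
    rwa [proj_of_mem hi hx, proj_of_mem_ne hi (vac_mem_eig _) hl.ne', Submodule.span_zero_singleton]
      at this
  · have := hp 0 le_rfl x
    rwa [proj_of_mem hi hx, proj_of_mem hi (vac_mem_eig _)] at this
  · rw [Submodule.span_singleton_le_iff_mem]
    exact vac_mem_eig _

lemma ncoef_zero_proj_eq_zero (Gb : A.IsCFTGrading (ω + A.T h))
    (hr1 : r ∈ filt Gb.internal 1) : A.ncoef 0 (proj Gb.internal 1 r) = 0 := by
  set w := proj Gb.internal 1 r with hw
  have hw1 : w ∈ A.eig (ω + A.T h) 1 := proj_mem _ _ _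
  have hw2 : w ∈ filt G.internal 2 :=
    proj_eigen_mem Gb.internal (fun x hx => G.ncoef_one_add_T_filt hh hx) hr 1
  have key : ∀ m : ℤ, ∀ x ∈ filt Gb.internal m, _ := fun m x hx =>
    leading_term Gb.internal (D := A.ncoef 1 (ω + A.T h + A.T r))
      (E := A.ncoef 1 (ω + A.T h) - A.ncoef 0 w)
      (fun i x hx => by
        rw [LinearMap.sub_apply, mem_eig.1 hx]
        exact Submodule.sub_mem _ (Submodule.smul_mem _ _ hx) (Gb.ncoef_zero_mem hw1 hx))
      (fun i x hx => by
        rw [ncoef_one_add_T (ω + A.T h), ← LinearMap.sub_apply, sub_sub_sub_cancel_left,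
          LinearMap.sub_apply, ← neg_sub, ← LinearMap.sub_apply, ← map_sub]
        exact Submodule.neg_mem _ (Gb.ncoef_zero_filt (sub_proj_mem_filt Gb.internal hr1)
          (mem_filt_of_mem _ hx le_rfl))) hx
  refine linearMap_ext Gb.internal fun n x hx => ?_
  suffices A.eig (ω + A.T h) n ≤ LinearMap.ker (A.ncoef 0 w) from this hx
  refine le_of_leading_terms Gb.internal (fun m x hx => (key m x hx).1) Ga.internal
    fun l x hx hl => ?_
  have h2 := (key n x hx).2
  rw [mem_eigen.1 hl, map_smul, LinearMap.sub_apply, mem_eig.1 (proj_mem Gb.internal n x)] at h2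
  refine eq_zero_of_raising G.internal (φ := A.ncoef 0 w) (c := (n : K) - l) (fun i y hy =>
    G.ncoef_zero_filt (by simpa using hw2) (mem_filt_of_mem _ hy le_rfl)) ?_
  rw [sub_smul, h2]
  abel

lemma mem_filt_add_T (Gb : A.IsCFTGrading (ω + A.T h)) : r ∈ filt Gb.internal 2 := by
  have hst : ∀ n, proj Gb.internal n r ∈ filt G.internal 2 := fun n =>
    proj_eigen_mem Gb.internal (fun x hx => G.ncoef_one_add_T_filt hh hx) hr n
  have hr1 : r ∈ filt Gb.internal 1 := by
    rw [show (1 : ℤ) = 0 + 1 from rfl]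
    refine filt_succ_of_proj Gb.internal (Gb.mem_filt_zero r) ?_
    have h0 : proj Gb.internal 0 r ∈ A.eig ω 0 := by
      rw [G.eig_zero, ← Gb.eig_zero]
      exact proj_mem _ _ _
    rw [← proj_of_mem G.internal h0]
    exact (mem_filt G.internal).1 (hst 0) 0 two_pos
  rw [show (2 : ℤ) = 1 + 1 from rfl]
  refine filt_succ_of_proj Gb.internal hr1 ?_
  have hw1 := proj_mem Gb.internal 1 r
  obtain ⟨y, k, hy⟩ :=
    G.exists_sub_eq_of_ncoef_zero (G.ncoef_zero_proj_eq_zero hh hr Ga Gb hr1)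
  have hL : A.ncoef 1 ω (proj Gb.internal 1 r) ∈ A.eig (ω + A.T h) 1 := by
    rw [show A.ncoef 1 ω = A.ncoef 1 (ω + A.T h) + A.ncoef 0 h by rw [ncoef_one_add_T]; abel,
      LinearMap.add_apply, mem_eig.1 hw1]
    exact Submodule.add_mem _ (Submodule.smul_mem _ _ hw1)
      (Gb.ncoef_zero_mem (G.mem_eig_add_T hh) hw1)
  have h2 := Gb.eq_of_mem (Submodule.sub_mem _ hw1 hL) hy
  rw [map_add, Gb.proj_T_of_nonpos le_rfl, map_smul,
    proj_of_mem_ne _ (vac_mem_eig _) zero_ne_one, smul_zero, add_zero, sub_eq_zero] at h2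
  have hV : proj Gb.internal 1 r ∈ A.eig ω 1 := by
    rw [mem_eig, ← h2, Int.cast_one, one_smul]
  rw [← proj_of_mem G.internal hV]
  exact (mem_filt G.internal).1 (hst 1) 1 one_lt_two

omit hh hr Ga

/-- A conformal vector of CFT type of the form `ω + T u` is conjugate to its truncation
to degree two. -/
theorem exists_aut_add_T {a u : V} (Ga : A.IsCFTGrading a) (ha : a = ω + A.T u) :
    ∃ h ∈ A.eig ω 1, A.IsCFTGrading (ω + A.T h) ∧
      (A.eig ω 1 ≤ ⨆ l : {l : ℤ // 1 ≤ l}, A.eig ω 1 ⊓ A.eig (ω + A.T h) l) ∧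
      ∃ g : V → V, A.IsVAAut g ∧ g a = ω + A.T h ∧
        ∀ n : ℤ, ∀ w ∈ A.eig a n, w ∈ A.eig (ω + A.T h) n → g w = w := by
  have hh := proj_mem G.internal 1 u
  have h0 := proj_mem G.internal 0 u
  set h := proj G.internal 1 u
  set r := u - proj G.internal 0 u - h with hrdef
  have hr : r ∈ filt G.internal 2 := by
    have h1 := sub_proj_mem_filt G.internal (G.mem_filt_zero u)
    rw [zero_add] at h1
    have h2 := sub_proj_mem_filt G.internal h1
    rwa [map_sub, proj_of_mem_ne _ h0 zero_ne_one, sub_zero] at h2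
  have hr' : u = proj G.internal 0 u + h + r := by rw [hrdef]; abel
  rw [hr', map_add, map_add, G.T_eq_zero_of_mem h0, zero_add, ← add_assoc] at ha
  subst ha
  have Gb := G.isCFTGrading_add_T hh hr Ga
  have hrb := G.mem_filt_add_T hh hr Ga Gb
  refine ⟨h, hh, Gb, G.eig_le_iSup hh hr Ga le_rfl, ?_⟩
  obtain ⟨g, hg, hgp, hgf, hgm⟩ := exists_leading_term_equiv Gb.internal
    (D := A.ncoef 1 (ω + A.T h + A.T r)) (fun n x hx => by
      rw [ncoef_one_add_T (ω + A.T h), LinearMap.sub_apply, mem_eig.1 hx, sub_sub_cancel_left]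
      exact Submodule.neg_mem _ (Gb.ncoef_zero_filt (by simpa using hrb)
        (mem_filt_of_mem _ hx le_rfl))) Ga.internal
  refine ⟨g, isVAAut_of_linearMap hg (fun k => hgm (A.ncoef k) (-k - 1)
    (fun m n x hx y hy => ncoef_mem_eig Gb.zero_eq_T k m n hx hy)
    (fun m n x hx y hy => ncoef_mem_eig Ga.zero_eq_T k m n hx hy))
    (hgf 0 _ (vac_mem_eig _) (vac_mem_eig _)), ?_, hgf⟩
  rw [hgp 2 _ Ga.self_mem, map_add, proj_of_mem _ Gb.self_mem]
  have := proj_T Gb.zero_eq_T Gb.internal 1 r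
  rw [show (1 : ℤ) + 1 = 2 by norm_num] at this
  rw [this, (mem_filt Gb.internal).1 hrb 1 one_lt_two, map_zero, add_zero]

end IsCFTGrading
end VA

namespace InternalGrading

variable {K V : Type*} [Field K] [AddCommGroup V] [Module K V]

lemma proj_eigen_map {D : V →ₗ[K] V} (hD : DirectSum.IsInternal (eigen D)) (n : ℤ) (v : V) :
    proj hD n (D v) = (n : K) • proj hD n v := by
  have h := proj_map hD hD D 0 (fun n x hx => by
    rw [add_zero, mem_eigen.1 hx]
    exact Submodule.smul_mem _ _ hx) n v
  rw [add_zero] at h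
  rw [h, mem_eigen.1 (proj_mem hD n v)]

lemma mem_eigen_neg {D : V →ₗ[K] V} {n : ℤ} {v : V} : v ∈ eigen (-D) n ↔ v ∈ eigen D (-n) := by
  rw [mem_eigen, mem_eigen, LinearMap.neg_apply, neg_eq_iff_eq_neg, Int.cast_neg, neg_smul]

lemma isInternal_eigen_neg [CharZero K] {D : V →ₗ[K] V} (hD : DirectSum.IsInternal (eigen D)) :
    DirectSum.IsInternal (eigen (-D)) := by
  rw [isInternal_eigen_iff] at *
  rw [← hD, ← (Equiv.neg ℤ).iSup_comp]
  exact iSup_congr fun n => Submodule.ext fun v => by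
    rw [mem_eigen_neg, Equiv.neg_apply, neg_neg]

end InternalGrading

namespace VA

open InternalGrading

variable {K V : Type*} [Field K] [CharZero K] [AddCommGroup V] [Module K V] {A : VA K V}

namespace IsCFTGrading

variable {ω : V} (G : A.IsCFTGrading ω)

include G

lemma eq_add_T_of_ncoef_zero {v : V} (hv : A.ncoef 0 v = 0) :
    ∃ k : K, ∃ J ∈ A.eig ω 1, ∃ u, A.ncoef 0 J = 0 ∧ v = k • A.vac + J + A.T u := by
  obtain ⟨y, c, hy⟩ := G.exists_sub_eq_of_ncoef_zero hv
  have hm : v ∈ Submodule.span K {A.vac} ⊔ A.eig ω 1 ⊔ LinearMap.range A.T := by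
    refine mem_of_proj_mem G.internal fun n => ?_
    by_cases hn : n = 1
    · subst hn
      exact Submodule.mem_sup_left (Submodule.mem_sup_right (proj_mem _ _ _))
    · have h := congrArg (proj G.internal n) hy
      have h2 : proj G.internal n (A.ncoef 1 ω v) = (n : K) • proj G.internal n v :=
        proj_eigen_map G.internal n v
      have h3 := proj_T G.zero_eq_T G.internal (n - 1) y
      rw [sub_add_cancel] at h3
      have h1 : (1 - n : K) ≠ 0 := by
        rw [sub_ne_zero]
        exact_mod_cast Ne.symm hn
      rw [map_sub, h2, map_add, h3, map_smul] at h
      rw [← Submodule.smul_mem_iff _ h1, sub_smul, one_smul, h]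
      refine Submodule.add_mem _ (Submodule.mem_sup_right ⟨_, rfl⟩)
        (Submodule.smul_mem _ _ (Submodule.mem_sup_left (Submodule.mem_sup_left ?_)))
      by_cases hn0 : n = 0
      · subst hn0
        rw [proj_of_mem _ (vac_mem_eig ω)]
        exact Submodule.mem_span_singleton_self _
      · rw [proj_of_mem_ne _ (vac_mem_eig ω) (Ne.symm hn0)]
        exact Submodule.zero_mem _
  obtain ⟨x, hx, _, ⟨u, rfl⟩, rfl⟩ := Submodule.mem_sup.1 hm
  obtain ⟨z, hz, J, hJ, rfl⟩ := Submodule.mem_sup.1 hx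
  obtain ⟨k, rfl⟩ := Submodule.mem_span_singleton.1 hz
  refine ⟨k, J, hJ, u, ?_, rfl⟩
  rwa [map_add, map_add, map_smul, T_ncoef_zero, vac_ncoef_of_ne (by norm_num), smul_zero,
    zero_add, add_zero] at hv

lemma exists_eq_T_of_ncoef_zero {v : V} (hv : A.ncoef 0 v = 0) (hv2 : v ∈ A.eig ω 2) :
    ∃ h ∈ A.eig ω 1, v = A.T h := by
  obtain ⟨k, J, hJ, u, -, hu⟩ := G.eq_add_T_of_ncoef_zero hv
  refine ⟨proj G.internal 1 u, proj_mem _ _ _, ?_⟩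
  have h3 := proj_T G.zero_eq_T G.internal 1 u
  rw [one_add_one_eq_two] at h3
  rw [G.eq_of_mem hv2 hu, map_add, map_add, map_smul, h3,
    proj_of_mem_ne _ (vac_mem_eig ω) two_ne_zero.symm, proj_of_mem_ne _ hJ (by norm_num), smul_zero,
    zero_add, zero_add]

section Lowering

variable {J : V} (hJ : J ∈ A.eig ω 1)

include hJ

lemma ncoef_one_mem {n : ℤ} {x : V} (hx : x ∈ A.eig ω n) : A.ncoef 1 J x ∈ A.eig ω (n - 1) := by
  have h := ncoef_mem_eig G.zero_eq_T 1 1 n hJ hx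
  rwa [show 1 + n + (-1 - 1) = n - 1 by ring] at h

lemma ncoef_one_conformal : A.ncoef 1 J ω = J := by
  obtain ⟨z, hz⟩ := G.skew_one ω J
  have h := G.ncoef_one_mem hJ G.self_mem
  rw [show (2 : ℤ) - 1 = 1 by norm_num] at h
  rw [G.eq_of_mem h hz, map_add, map_sub, G.proj_T_of_nonpos le_rfl, G.proj_T_T (by norm_num),
    mem_eig.1 hJ, Int.cast_one, one_smul, sub_zero, add_zero, proj_of_mem _ hJ]

lemma isInternal_eig_add : DirectSum.IsInternal (A.eig (ω + J)) := by
  rw [eig_eq_eigen, isInternal_eigen_iff, eq_top_iff, ← iSup_eq_top G.internal, iSup_le_iff]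
  have key : ∀ n : ℕ, A.eig ω n ≤ ⨆ l : {l : ℤ // l ≤ n}, A.eig (ω + J) l := by
    intro n
    induction n with
    | zero =>
      rw [Nat.cast_zero, G.eig_zero, Submodule.span_singleton_le_iff_mem]
      exact Submodule.mem_iSup_of_mem (⟨0, le_rfl⟩ : {l : ℤ // l ≤ 0}) (vac_mem_eig _)
    | succ n ih =>
      intro v hv
      have h1 := G.ncoef_one_mem hJ hv
      rw [Nat.cast_succ, add_sub_cancel_right] at h1
      have h2 : (⨆ l : {l : ℤ // l ≤ n}, A.eig (ω + J) l) ≤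
          (⨆ l : {l : ℤ // l ≤ n}, A.eig (ω + J) l).map
            (A.ncoef 1 (ω + J) - ((n : K) + 1) • LinearMap.id) := by
        refine iSup_le fun l y hy => ?_
        have hl : (l : K) - (n + 1) ≠ 0 := by
          have := l.2
          rw [sub_ne_zero]
          exact_mod_cast (by omega : (l : ℤ) ≠ n + 1)
        refine ⟨((l : K) - (n + 1))⁻¹ • y,
          Submodule.smul_mem _ _ (Submodule.mem_iSup_of_mem l hy), ?_⟩
        rw [map_smul, LinearMap.sub_apply, LinearMap.smul_apply, LinearMap.id_apply,
          mem_eig.1 hy, ← sub_smul, inv_smul_smul₀ hl]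
      obtain ⟨x, hx, hxv⟩ := h2 (ih h1)
      rw [← sub_add_cancel v x]
      refine Submodule.add_mem _ (Submodule.mem_iSup_of_mem
        (⟨n + 1, by simp⟩ : {l : ℤ // l ≤ (n + 1 : ℕ)}) ?_)
        (iSup_le (fun l : {l : ℤ // l ≤ n} => le_iSup
          (fun l : {l : ℤ // l ≤ (n + 1 : ℕ)} => A.eig (ω + J) l)
          ⟨l, l.2.trans (by simp)⟩) hx)
      rw [LinearMap.sub_apply, LinearMap.smul_apply, LinearMap.id_apply] at hxv
      rw [mem_eig] at hv
      change _ ∈ A.eig (ω + J) (n + 1)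
      rw [mem_eig, map_sub, smul_sub]
      nth_rewrite 1 [map_add]
      rw [LinearMap.add_apply, ← hxv, hv]
      push_cast
      abel
  intro n
  rcases lt_or_ge n 0 with hn | hn
  · rw [G.eig_neg n hn]
    exact bot_le
  · lift n to ℕ using hn
    exact (key n).trans (iSup_le fun l => le_iSup (A.eig (ω + J)) l)

/-- Deforming the conformal vector by a weight-one vector with vanishing zeroth product amounts to
an automorphism. -/
lemma exists_aut_add (hJ0 : A.ncoef 0 J = 0) :
    ∃ c : K, ∃ g : V → V, A.IsVAAut g ∧ g (ω + J + c • A.vac) = ω := by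
  have hκ := G.ncoef_one_mem hJ hJ
  rw [sub_self, G.eig_zero] at hκ
  obtain ⟨κ, hκ⟩ := Submodule.mem_span_singleton.1 hκ
  have h0 : A.ncoef 0 (ω + J) = A.T := by rw [map_add, hJ0, add_zero, G.zero_eq_T]
  have hU := isInternal_eigen_neg (D := A.ncoef 1 ω) G.internal
  have hJU : J ∈ eigen (-A.ncoef 1 ω) (-1) := by rwa [mem_eigen_neg, neg_neg]
  have hωU : ω ∈ eigen (-A.ncoef 1 ω) (-2) := by
    rw [mem_eigen_neg, neg_neg]
    exact G.self_mem
  have hvU (e : V) : A.vac ∈ eigen (-A.ncoef 1 e) 0 := by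
    rw [mem_eigen_neg, neg_zero]
    exact vac_mem_eig e
  have hβ {e : V} (he : A.ncoef 0 e = A.T) (k m n : ℤ) {x y : V} (hx : x ∈ eigen (-A.ncoef 1 e) m)
      (hy : y ∈ eigen (-A.ncoef 1 e) n) :
      A.ncoef k x y ∈ eigen (-A.ncoef 1 e) (m + n + (k + 1)) := by
    rw [mem_eigen_neg] at *
    have h := ncoef_mem_eig he k (-m) (-n) hx hy
    rwa [show -m + -n + (-k - 1) = -(m + n + (k + 1)) by ring] at h
  obtain ⟨g, hg, hgp, hgf, hgm⟩ := exists_leading_term_equiv hU (D := -A.ncoef 1 (ω + J))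
    (fun n x hx => by
      rw [map_add, neg_add, LinearMap.add_apply, mem_eigen.1 hx, add_sub_cancel_left]
      rw [mem_eigen_neg] at hx
      refine mem_filt_of_mem _ (Submodule.neg_mem _ (mem_eigen_neg.2 ?_)) le_rfl
      have := G.ncoef_one_mem hJ hx
      rwa [show -n - 1 = -(n + 1) by ring] at this)
    (isInternal_eigen_neg (G.isInternal_eig_add hJ))
  refine ⟨κ / 2, g, isVAAut_of_linearMap hg (fun k => hgm (A.ncoef k) (k + 1)
    (fun m n x hx y hy => hβ G.zero_eq_T k m n hx hy) (fun m n x hx y hy => hβ h0 k m n hx hy))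
    (hgf 0 _ (hvU _) (hvU _)), ?_⟩
  rw [hgp (-2), map_add, map_add, map_smul, proj_of_mem _ hωU,
    proj_of_mem_ne _ hJU (by norm_num), proj_of_mem_ne _ (hvU _) (by norm_num), smul_zero,
    add_zero, add_zero]
  rw [mem_eigen_neg, neg_neg, mem_eigen, map_add, map_smul, (mem_eig.1 (vac_mem_eig _)),
    map_add (A.ncoef 1), LinearMap.add_apply, map_add, map_add, G.ncoef_one_conformal hJ, ← hκ,
    mem_eig.1 G.self_mem, mem_eig.1 hJ]
  push_cast
  module

end Lowering

/-- Every conformal vector of CFT type is conjugate to one which is homogeneous of degree two. -/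
theorem exists_aut_map_mem_eig_two {a : V} (Ga : A.IsCFTGrading a) :
    ∃ g : V → V, A.IsVAAut g ∧ g a ∈ A.eig ω 2 := by
  have hv : A.ncoef 0 (a - ω) = 0 := by rw [map_sub, Ga.zero_eq_T, G.zero_eq_T, sub_self]
  obtain ⟨k, J, hJ, u, hJ0, hu⟩ := G.eq_add_T_of_ncoef_zero hv
  obtain ⟨c, g, hg, hgω⟩ := G.exists_aut_add hJ hJ0
  have hga : g a = ω + (k - c) • A.vac + A.T (g u) := by
    rw [show a = ω + J + c • A.vac + (k - c) • A.vac + A.T u by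
      rw [sub_eq_iff_eq_add] at hu; rw [hu]; module, hg.1.map_add, hg.1.map_add, hgω,
      hg.1.map_smul, hg.1.map_vac, hg.1.map_T]
  have G1 := hg.isCFTGrading_map Ga
  have hc : (k - c) • A.vac = 0 := by
    have h := mem_eig.1 G1.self_mem
    rw [hga] at h
    obtain ⟨z, hz⟩ := G.skew_zero ω (g u)
    have hT := T_comm G.zero_eq_T 0 (g u) (g u)
    rw [Int.cast_zero, zero_smul, sub_zero] at hT
    have hL (x : V) : proj G.internal 0 (A.ncoef 1 ω x) = 0 := by
      have : proj G.internal 0 (A.ncoef 1 ω x) = ((0 : ℤ) : K) • proj G.internal 0 x :=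
        proj_eigen_map G.internal 0 x
      rw [this, Int.cast_zero, zero_smul]
    have hT0 (x : V) := G.proj_T_of_nonpos zero_le_one x
    have h2 := congrArg (proj G.internal 0) h
    simp only [map_add, map_smul, LinearMap.add_apply, T_ncoef_one,
      vac_ncoef_of_ne (A := A) (by norm_num : (1 : ℤ) ≠ -1), LinearMap.zero_apply, smul_zero,
      LinearMap.neg_apply, map_neg, hL, hz, ← hT, hT0, map_sub, G.zero_eq_T,
      A.ncoef_vac_zero 0 le_rfl, map_zero, proj_of_mem G.internal (vac_mem_eig ω),
      proj_of_mem_ne G.internal G.self_mem two_ne_zero] at h2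
    simpa [eq_comm] using h2
  rw [hc, add_zero] at hga
  obtain ⟨h, hh, -, -, g', hg', hg'a, -⟩ := G.exists_aut_add_T G1 hga
  refine ⟨g' ∘ g, hg'.comp hg, ?_⟩
  rw [Function.comp_apply, hg'a]
  exact G.add_T_mem_eig_two hh

end IsCFTGrading
end VA

namespace VA

open InternalGrading

variable {K V : Type*} [Field K] [AddCommGroup V] [Module K V] {A : VA K V}

/-- The vectors all of whose images under modes are killed by `φ`. -/
def modeKernel (A : VA K V) (φ : V →ₗ[K] V) : Submodule K V :=
  ⨅ (n : ℤ) (v : V), LinearMap.ker (φ ∘ₗ A.ncoef n v)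

lemma mem_modeKernel {φ : V →ₗ[K] V} {w : V} :
    w ∈ A.modeKernel φ ↔ ∀ n v, φ (A.ncoef n v w) = 0 := by
  simp [modeKernel]

lemma ncoef_mem_modeKernel {φ : V →ₗ[K] V} {w : V} (hw : w ∈ A.modeKernel φ) (l : ℤ) (u : V) :
    A.ncoef l u w ∈ A.modeKernel φ := by
  obtain ⟨M, hM⟩ := A.trunc u w
  suffices ∀ (N : ℕ) (l : ℤ), M ≤ l + N → A.ncoef l u w ∈ A.modeKernel φ from
    this (M - l).toNat l (by omega)
  intro N
  induction N with
  | zero =>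
    intro l hl
    rw [hM l (by simpa using hl)]
    exact Submodule.zero_mem _
  | succ N ih =>
    intro l hl
    rw [mem_modeKernel] at hw ⊢
    intro k v
    obtain ⟨m, hm⟩ := A.trunc v w
    have h := (A.borcherds v u w (k - m) l m).symm
    rw [finsum_eq_sum_of_support_subset (s := Finset.range (N + 2)), Finset.sum_range_succ'] at h
    · have h2 := congrArg φ h
      rw [map_add, map_sum, Finset.sum_eq_zero, zero_add] at h2
      · rw [hm _ (by simp), map_zero, smul_zero, sub_zero] at h2
        simp only [pow_zero, zBinom_zero_right, mul_one, one_smul, Nat.cast_zero, add_zero,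
          sub_zero, add_sub_cancel] at h2
        rw [h2]
        refine finsum_induction (fun x => φ x = 0) (map_zero φ)
          (fun x y hx hy => by rw [map_add, hx, hy, add_zero]) fun i => ?_
        rw [map_smul, hw, smul_zero]
      · intro i _
        rw [hm _ (by omega), map_zero, smul_zero, sub_zero, map_smul,
          mem_modeKernel.1 (ih _ (by push_cast at hl ⊢; omega)), smul_zero]
    · intro i hi
      by_contra hi2
      rw [Finset.mem_coe, Finset.mem_range, not_lt] at hi2
      refine hi ?_
      simp only
      rw [hM _ (by push_cast at hl; omega), hm _ (by omega)]
      simp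

lemma isIdeal_modeKernel [CharZero K] {e : V} (he : A.ncoef 0 e = A.T) (φ : V →ₗ[K] V) :
    A.IsIdeal (A.modeKernel φ) := fun n a _ hb =>
  ⟨ncoef_mem_modeKernel hb n a, skew_symmetry_mem he
    (fun x hx => by rw [← he]; exact ncoef_mem_modeKernel hx 0 e)
    (fun n => ncoef_mem_modeKernel hb n a) n⟩

namespace IsCFTGrading

variable [CharZero K] {ω : V} (G : A.IsCFTGrading ω) (hω : ∀ v ∈ A.eig ω 1, A.ncoef 2 ω v = 0)

include G hω

lemma ncoef_eq_zero_of_ncoef_one {h : V} (hh : h ∈ A.eig ω 1)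
    (h1 : ∀ v ∈ A.eig ω 1, A.ncoef 1 h v = 0) (n : ℕ) :
    ∀ v ∈ A.eig ω n, A.ncoef n h v = 0 := by
  induction n with
  | zero =>
    intro v hv
    rw [Nat.cast_zero, G.eig_zero, Submodule.mem_span_singleton] at hv
    obtain ⟨c, rfl⟩ := hv
    rw [map_smul, Nat.cast_zero, A.ncoef_vac_zero 0 le_rfl, smul_zero]
  | succ n ih =>
    intro v hv
    rcases Nat.eq_zero_or_pos n with rfl | hn
    · simpa using h1 v (by simpa using hv)
    have hc := A.commutator_two n ω h v
    have m1 := ncoef_mem_eig G.zero_eq_T n 1 (n + 1 : ℕ) hh hv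
    rw [show (1 : ℤ) + (n + 1 : ℕ) + (-n - 1) = 1 by push_cast; ring] at m1
    have m2 := ncoef_mem_eig G.zero_eq_T 2 2 (n + 1 : ℕ) G.self_mem hv
    rw [show (2 : ℤ) + (n + 1 : ℕ) + (-2 - 1) = n by push_cast; ring] at m2
    rw [hω _ m1, ih _ m2, G.zero_eq_T, T_ncoef, hω _ hh, mem_eig.1 hh, map_zero,
      LinearMap.zero_apply, add_zero, sub_zero, Int.cast_one, one_smul,
      show (n : ℤ) + 2 - 1 = n + 1 by ring, ← add_smul, eq_comm, smul_eq_zero] at hc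
    rw [Nat.cast_succ]
    refine hc.resolve_left ?_
    push_cast
    rw [show (-((n : K) + 2) + 2) = -n by ring, neg_eq_zero]
    exact_mod_cast hn.ne'

/-- In a simple vertex operator algebra of strong CFT type, the pairing on the weight-one space
induced by the first product is nondegenerate. -/
theorem eq_zero_of_ncoef_one (hs : A.IsSimple) {h : V} (hh : h ∈ A.eig ω 1)
    (h1 : ∀ v ∈ A.eig ω 1, A.ncoef 1 h v = 0) : h = 0 := by
  have hI : h ∈ A.modeKernel (proj G.internal 0) := by
    rw [mem_modeKernel]
    intro n v
    refine induction_on G.internal v (fun d x hx => ?_) (by simp)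
      fun x y hx hy => by rw [map_add, LinearMap.add_apply, map_add, hx, hy, add_zero]
    by_cases hdn : d = n
    · subst hdn
      rcases lt_or_ge d 0 with hd | hd
      · rw [G.eig_neg d hd, Submodule.mem_bot] at hx
        simp [hx]
      · lift d to ℕ using hd
        obtain ⟨z, hz⟩ := A.exists_skew_symmetry G.zero_eq_T d h x
        rw [hz, G.ncoef_eq_zero_of_ncoef_one hω hh h1 d x hx, map_smul, map_add, map_sub,
          map_zero, G.proj_T_of_nonpos zero_le_one, G.proj_T_of_nonpos zero_le_one, sub_zero,
          add_zero, smul_zero]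
    · exact proj_of_mem_ne _ (ncoef_mem_eig G.zero_eq_T n d 1 hx hh) (by omega)
  rcases hs _ (isIdeal_modeKernel G.zero_eq_T (proj G.internal 0)) with hbot | htop
  · rwa [hbot, Submodule.mem_bot] at hI
  · have hvac : A.vac ∈ A.modeKernel (proj G.internal 0) := htop ▸ Submodule.mem_top
    have hv := mem_modeKernel.1 hvac (-1) A.vac
    rw [A.ncoef_vac, proj_of_mem _ (vac_mem_eig ω)] at hv
    rw [← A.ncoef_vac h, hv, map_zero]

/-- Conjugate conformal vectors of CFT type of degree two are conjugate under the stabilizer of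
`ω`. -/
theorem exists_aut_fixing (hs : A.IsSimple) {a b : V} (Ga : A.IsCFTGrading a)
    (ha : a ∈ A.eig ω 2) (Gb : A.IsCFTGrading b) (hb : b ∈ A.eig ω 2) {f : V → V}
    (hf : A.IsVAAut f) (hab : f a = b) : ∃ g : V → V, A.IsVAAut g ∧ g ω = ω ∧ g a = b := by
  obtain ⟨u, -, hu⟩ := G.exists_eq_T_of_ncoef_zero (v := a - ω)
    (by rw [map_sub, Ga.zero_eq_T, G.zero_eq_T, sub_self]) (Submodule.sub_mem _ ha G.self_mem)
  obtain ⟨v, -, hv⟩ := G.exists_eq_T_of_ncoef_zero (v := b - ω)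
    (by rw [map_sub, Gb.zero_eq_T, G.zero_eq_T, sub_self]) (Submodule.sub_mem _ hb G.self_mem)
  have hfω : f ω = ω + A.T (v - f u) := by
    rw [sub_eq_iff_eq_add] at hu hv
    have h := hab
    rw [hv, hu, hf.1.map_add, hf.1.map_T] at h
    rw [map_sub, eq_sub_of_add_eq' h]
    abel
  obtain ⟨h, hh, -, hle, g, hg, hgf, hfix⟩ :=
    G.exists_aut_add_T (hf.isCFTGrading_map G) hfω
  have hgf' := hg.comp hf
  have h0 : h = 0 := by
    refine G.eq_zero_of_ncoef_one hω hs hh fun x hx => ?_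
    suffices A.eig ω 1 ≤ LinearMap.ker (A.ncoef 1 h) from this hx
    refine hle.trans (iSup_le fun l x hx => ?_)
    obtain ⟨hx1, hxl⟩ := hx
    have e1 := mem_eig.1 hxl
    rw [ncoef_one_add_T, LinearMap.sub_apply, mem_eig.1 hx1, sub_eq_iff_eq_add,
      ← sub_eq_iff_eq_add', ← sub_smul] at e1
    rw [LinearMap.mem_ker]
    by_cases hl : (l : ℤ) = 1
    · obtain ⟨w, rfl⟩ := hgf'.2.2 x
      have hw : w ∈ A.eig ω 1 := by
        rw [hl] at hxl
        change _ ∈ A.eig _ 1 at hxl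
        rw [← hgf, mem_eig] at hxl
        rw [mem_eig]
        refine hgf'.2.1 ?_
        rw [hgf'.1.map_ncoef, hgf'.1.map_smul]
        exact hxl
      have h2 := hgf'.1.map_ncoef 2 ω w
      rw [hω w hw, Function.comp_apply (x := ω), hgf, map_add, LinearMap.add_apply, hω _ hx1,
        T_ncoef, zero_add] at h2
      have h3 : (g ∘ f) 0 = 0 := by simpa using hgf'.1.map_smul 0 0
      rw [h3, eq_comm, smul_eq_zero] at h2
      exact h2.resolve_left (by norm_num)
    · have h2 := A.commutator_zero 1 h h x
      have h3 := G.ncoef_one_mem hh hx1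
      rw [sub_self, G.eig_zero, Submodule.mem_span_singleton] at h3
      obtain ⟨c, hc⟩ := h3
      rw [G.ncoef_zero_self hh, ← e1, ← hc, map_smul, A.ncoef_vac_zero 0 le_rfl, map_smul, map_zero,
        smul_zero, zero_sub, LinearMap.zero_apply, neg_eq_zero, smul_eq_zero] at h2
      refine h2.resolve_left ?_
      rw [sub_eq_zero]
      exact_mod_cast Ne.symm hl
  rw [h0, map_zero, add_zero] at hgf hfix
  refine ⟨g ∘ f, hgf', hgf, ?_⟩
  rw [Function.comp_apply, hab]
  refine hfix 2 b ?_ hb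
  rw [← hab]
  exact hf.map_mem_eig ha

end IsCFTGrading
end VA

section

open InternalGrading

variable {K V : Type*} [Field K] [AddCommGroup V] [Module K V] {A : VA K V}

lemma GradedVA.isInternal (G : GradedVA A) : DirectSum.IsInternal G.gr :=
  letI := G.decomp
  DirectSum.Decomposition.isInternal G.gr

lemma ConfGVA.gr_eq_eig [CharZero K] (C : ConfGVA A) (n : ℤ) : C.gr n = A.eig C.ω n := by
  refine le_antisymm (fun v hv => VA.mem_eig.2 (C.L0_grading n v hv)) fun v hv => ?_
  refine mem_of_proj_mem C.isInternal fun m => ?_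
  by_cases hmn : m = n
  · subst hmn
    exact proj_mem _ _ _
  · have h := proj_map C.isInternal C.isInternal (A.ncoef 1 C.ω) 0 (fun i x hx => by
      rw [add_zero, C.L0_grading i x hx]
      exact Submodule.smul_mem _ _ hx) m v
    rw [add_zero, C.L0_grading m _ (proj_mem _ _ _), VA.mem_eig.1 hv, map_smul, ← sub_eq_zero,
      ← sub_smul, smul_eq_zero] at h
    rw [h.resolve_left (by rw [sub_eq_zero]; exact_mod_cast Ne.symm hmn)]
    exact Submodule.zero_mem _

lemma VOACFT.isCFTGrading [CharZero K] (W : VOACFT A) : A.IsCFTGrading W.ω where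
  zero_eq_T := W.Lneg1_eq_T
  internal := funext W.gr_eq_eig ▸ W.isInternal
  eig_neg n hn := by rw [← W.gr_eq_eig, W.gr_neg n hn]
  eig_zero := by rw [← W.gr_eq_eig, W.gr_zero]
  self_mem := by
    rw [← W.gr_eq_eig]
    exact W.ω_mem

end

/-- Theorem `classify`: for a simple VOA of strong CFT type,
the natural map `(V_2 ∩ CV_CFT)/Aut_ω V → CV_CFT/Aut V` is a bijection: every
`Aut V`-orbit in `CV_CFT` meets `V_2 ∩ CV_CFT` (surjectivity), and two elements of
`V_2 ∩ CV_CFT` conjugate under `Aut V` are already conjugate under `Aut_ω V`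
(injectivity). -/
theorem orbit_map_bijective_CVCFT {K V : Type*} [RCLike K]
    [AddCommGroup V] [Module K V]
    (A : VA K V) (W : VOAsCFT A) (hs : A.IsSimple) :
    (∀ a : V, A.IsConformalCFT a →
      ∃ b : V, b ∈ W.gr 2 ∧ A.IsConformalCFT b ∧
        ∃ f : V → V, A.IsVAAut f ∧ f b = a) ∧
    (∀ a b : V, a ∈ W.gr 2 → A.IsConformalCFT a → b ∈ W.gr 2 → A.IsConformalCFT b →
      (∃ f : V → V, A.IsVAAut f ∧ f a = b) →
      ∃ g : V → V, A.IsVAAut g ∧ g W.ω = W.ω ∧ g a = b) := by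
  have G := W.isCFTGrading
  simp only [W.gr_eq_eig]
  refine ⟨fun a ha => ?_, fun a b ha hca hb hcb ⟨f, hf, hab⟩ => ?_⟩
  · obtain ⟨g, hg, hga⟩ := G.exists_aut_map_mem_eig_two ha.isCFTGrading
    obtain ⟨f, hf, hfg⟩ := hg.exists_inverse
    exact ⟨g a, hga, hg.isConformalCFT_map ha, f, hf, hfg a⟩
  · exact G.exists_aut_fixing (fun v hv => W.L1_V1 v (by rwa [W.gr_eq_eig])) hs
      hca.isCFTGrading ha hcb.isCFTGrading hb hf hab
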